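/- arXiv:math/0606038 — 6 statements merged into one kernel-verified Lean document; each statement's English description precedes it below -/
import Mathlib

section
/- Let E0 ∈ ℝ and L ≥ 1, and let E′ and E″ be two distinct zeros of the orthonormal polynomial p_L. Then (|E′ − E0| + |E″ − E0|)·‖A_L(E0)‖ ≥ 1, where ‖A_L(E0)‖ is the operator norm of A_L(E0). In particular, if z_L^{(1)}(E0) and z_L^{(−1)}(E0) exist, then (z_L^{(1)}(E0) − z_L^{(−1)}(E0))·‖A_L(E0)‖ ≥ 1. -/
open scoped BigOperators

/-- The solution of the Jacobi difference equation at energy `E` with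
boundary condition angle `θ`: `u 0 = sin θ`, `u 1 = cos θ`, and
`a n * u (n+1) + (b n - E) * u n + a (n-1) * u (n-1) = 0` for `n ≥ 1`. -/
noncomputable def jacobiSol (a b : ℕ → ℝ) (E θ : ℝ) : ℕ → ℝ
  | 0 => Real.sin θ
  | 1 => Real.cos θ
  | (n+2) => (-((b (n+1) - E) * jacobiSol a b E θ (n+1) + a n * jacobiSol a b E θ n)) / a (n+1)

/-- The orthonormal polynomial `p n` evaluated at `x`; `p n x = u (n+1)` for the
solution with `θ = 0` (so that `u 0 = p_{-1} = 0`, `u 1 = p_0 = 1`). -/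
noncomputable def orthoP (a b : ℕ → ℝ) (n : ℕ) (x : ℝ) : ℝ := jacobiSol a b x 0 (n+1)

/-- The kernel `K(n,m;E)`. -/
noncomputable def Kker (a b : ℕ → ℝ) (E : ℝ) (n m : ℕ) : ℝ :=
  jacobiSol a b E 0 n * jacobiSol a b E (Real.pi/2) m
    - jacobiSol a b E (Real.pi/2) n * jacobiSol a b E 0 m

/-- The matrix of the operator `A_L(E)` on `ℂ^L`. -/
noncomputable def AL (a b : ℕ → ℝ) (E : ℝ) (L : ℕ) : Matrix (Fin L) (Fin L) ℂ :=
  Matrix.of fun i j =>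
    if (j : ℕ) ≤ (i : ℕ) then ((Kker a b E ((i : ℕ) + 1) ((j : ℕ) + 1) : ℝ) : ℂ) else 0

/-- The operator norm of a complex matrix acting on Euclidean space. -/
noncomputable def matOpNorm {L : ℕ} (A : Matrix (Fin L) (Fin L) ℂ) : ℝ :=
  ‖LinearMap.toContinuousLinearMap (Matrix.toEuclideanLin A)‖

theorem jac_rec (a b : ℕ → ℝ) (ha : ∀ n, 0 < a n) (E θ : ℝ) (n : ℕ) :
    a (n+1) * jacobiSol a b E θ (n+2)
      = -((b (n+1) - E) * jacobiSol a b E θ (n+1) + a n * jacobiSol a b E θ n) := by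
  have h := (ha (n+1)).ne'
  rw [jacobiSol]
  field_simp

theorem jac_wronsk (a b : ℕ → ℝ) (ha : ∀ n, 0 < a n) (E F θ φ : ℝ) (n : ℕ) :
    a n * (jacobiSol a b E θ (n+1) * jacobiSol a b F φ n
        - jacobiSol a b E θ n * jacobiSol a b F φ (n+1))
      = a 0 * (Real.cos θ * Real.sin φ - Real.sin θ * Real.cos φ)
        + (E - F) * ∑ m ∈ Finset.range n,
            jacobiSol a b E θ (m+1) * jacobiSol a b F φ (m+1) := by
  induction n with
  | zero => simp [jacobiSol]
  | succ n ih =>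
    rw [Finset.sum_range_succ, mul_add, ← add_assoc, ← ih]
    have h1 := jac_rec a b ha E θ n
    have h2 := jac_rec a b ha F φ n
    linear_combination jacobiSol a b F φ (n+1) * h1 - jacobiSol a b E θ (n+1) * h2

theorem jac_var (a b : ℕ → ℝ) (ha : ∀ n, 0 < a n) (ha0 : a 0 = 1) (E F : ℝ) (n : ℕ) :
    jacobiSol a b E 0 n = jacobiSol a b F 0 n + (E - F) * ∑ m ∈ Finset.range n,
      Kker a b F n (m+1) * jacobiSol a b E 0 (m+1) := by
  have h1 := jac_wronsk a b ha E F 0 0 n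
  have h2 := jac_wronsk a b ha E F 0 (Real.pi/2) n
  have h3 := jac_wronsk a b ha F F 0 (Real.pi/2) n
  simp [ha0] at h1 h2 h3
  have h4 : ∑ m ∈ Finset.range n, Kker a b F n (m+1) * jacobiSol a b E 0 (m+1)
      = jacobiSol a b F 0 n * (∑ m ∈ Finset.range n,
          jacobiSol a b E 0 (m+1) * jacobiSol a b F (Real.pi/2) (m+1))
        - jacobiSol a b F (Real.pi/2) n * (∑ m ∈ Finset.range n,
          jacobiSol a b E 0 (m+1) * jacobiSol a b F 0 (m+1)) := by
    rw [Finset.mul_sum, Finset.mul_sum, ← Finset.sum_sub_distrib]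
    refine Finset.sum_congr rfl fun m _ => ?_
    unfold Kker; ring
  rw [h4]
  linear_combination jacobiSol a b F 0 n * h2 - jacobiSol a b F (Real.pi/2) n * h1
    - jacobiSol a b E 0 n * h3

/-- The truncated solution as a vector. -/
noncomputable def jvec (a b : ℕ → ℝ) (E : ℝ) (L : ℕ) : EuclideanSpace ℂ (Fin L) :=
  WithLp.toLp 2 fun i => ((jacobiSol a b E 0 ((i : ℕ) + 1) : ℝ) : ℂ)

theorem jvec_var (a b : ℕ → ℝ) (ha : ∀ n, 0 < a n) (ha0 : a 0 = 1) (E F : ℝ) (L : ℕ) :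
    jvec a b E L = jvec a b F L
      + ((E - F : ℝ) : ℂ) • Matrix.toEuclideanLin (AL a b F L) (jvec a b E L) := by
  ext i
  have h := jac_var a b ha ha0 E F ((i : ℕ) + 1)
  have hs : ∑ j : Fin L, AL a b F L i j * ((jacobiSol a b E 0 ((j : ℕ) + 1) : ℝ) : ℂ)
      = ((∑ m ∈ Finset.range ((i : ℕ) + 1),
          Kker a b F ((i : ℕ) + 1) (m+1) * jacobiSol a b E 0 (m+1) : ℝ) : ℂ) := by
    have h1 : ∀ j : Fin L, AL a b F L i j * ((jacobiSol a b E 0 ((j : ℕ) + 1) : ℝ) : ℂ)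
        = (fun j : ℕ => if j ≤ (i : ℕ) then
          ((Kker a b F ((i : ℕ) + 1) (j+1) * jacobiSol a b E 0 (j+1) : ℝ) : ℂ) else 0) j := by
      intro j
      simp only [AL, Matrix.of_apply]
      split_ifs <;> simp
    rw [Finset.sum_congr rfl fun j _ => h1 j, Fin.sum_univ_eq_sum_range
      (fun j : ℕ => if j ≤ (i : ℕ) then
          ((Kker a b F ((i : ℕ) + 1) (j+1) * jacobiSol a b E 0 (j+1) : ℝ) : ℂ) else 0) L,
      ← Finset.sum_filter, Complex.ofReal_sum]
    refine Finset.sum_congr ?_ fun _ _ => rfl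
    ext m
    have := i.2
    simp only [Finset.mem_filter, Finset.mem_range]
    omega
  have hm : (Matrix.toEuclideanLin (AL a b F L) (jvec a b E L)) i
      = ∑ j : Fin L, AL a b F L i j * ((jacobiSol a b E 0 ((j : ℕ) + 1) : ℝ) : ℂ) := rfl
  rw [PiLp.add_apply, PiLp.smul_apply, hm, hs]
  simp only [jvec, smul_eq_mul]
  rw [← Complex.ofReal_mul, ← Complex.ofReal_add, ← h]

theorem jvec_orth (a b : ℕ → ℝ) (ha : ∀ n, 0 < a n) (E F : ℝ) (L : ℕ)
    (hne : E ≠ F) (hE : orthoP a b L E = 0) (hF : orthoP a b L F = 0) :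
    inner ℂ (jvec a b E L) (jvec a b F L) = 0 := by
  have h := jac_wronsk a b ha E F 0 0 L
  unfold orthoP at hE hF
  simp [hE, hF, sub_eq_zero, hne] at h
  rw [PiLp.inner_apply]
  have h1 : ∀ i : Fin L, inner ℂ ((jvec a b E L) i) ((jvec a b F L) i)
      = (fun m : ℕ => ((jacobiSol a b E 0 (m+1) * jacobiSol a b F 0 (m+1) : ℝ) : ℂ)) i := by
    intro i
    simp [jvec, mul_comm]
  rw [Finset.sum_congr rfl fun j _ => h1 j, Fin.sum_univ_eq_sum_range
    (fun m : ℕ => ((jacobiSol a b E 0 (m+1) * jacobiSol a b F 0 (m+1) : ℝ) : ℂ)) L,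
    ← Complex.ofReal_sum, h, Complex.ofReal_zero]

theorem jvec_pos (a b : ℕ → ℝ) (E : ℝ) (L : ℕ) (hL : 1 ≤ L) : 0 < ‖jvec a b E L‖ := by
  rw [norm_pos_iff]
  intro h
  have := congrArg (fun v : EuclideanSpace ℂ (Fin L) => v ⟨0, hL⟩) h
  simp [jvec, jacobiSol] at this

theorem jac_main (a b : ℕ → ℝ) (ha : ∀ n, 0 < a n) (ha0 : a 0 = 1)
    (E0 : ℝ) (L : ℕ) (hL : 1 ≤ L) (E F : ℝ) (hne : E ≠ F)
    (hE : orthoP a b L E = 0) (hF : orthoP a b L F = 0) :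
    1 ≤ (|E - E0| + |F - E0|) * matOpNorm (AL a b E0 L) := by
  have ho := jvec_orth a b ha E F L hne hE hF
  have hp := jvec_pos a b E L hL
  have hq := jvec_pos a b F L hL
  have v1 := jvec_var a b ha ha0 E E0 L
  have v2 := jvec_var a b ha ha0 F E0 L
  have hb : ∀ x, ‖Matrix.toEuclideanLin (AL a b E0 L) x‖ ≤ matOpNorm (AL a b E0 L) * ‖x‖ :=
    fun x => (LinearMap.toContinuousLinearMap
      (Matrix.toEuclideanLin (AL a b E0 L))).le_opNorm x
  have hN : 0 ≤ matOpNorm (AL a b E0 L) := norm_nonneg _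
  have b1 := hb (jvec a b E L)
  have b2 := hb (jvec a b F L)
  have hsq : ‖jvec a b E L - jvec a b F L‖ ^ 2 = ‖jvec a b E L‖ ^ 2 + ‖jvec a b F L‖ ^ 2 := by
    rw [@norm_sub_sq ℂ, ho]; simp
  have hd : jvec a b E L - jvec a b F L
      = ((E - E0 : ℝ) : ℂ) • Matrix.toEuclideanLin (AL a b E0 L) (jvec a b E L)
        - ((F - E0 : ℝ) : ℂ) • Matrix.toEuclideanLin (AL a b E0 L) (jvec a b F L) := by
    nth_rewrite 1 [v1]
    nth_rewrite 1 [v2]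
    abel
  have hle : ‖jvec a b E L - jvec a b F L‖
      ≤ |E - E0| * ‖Matrix.toEuclideanLin (AL a b E0 L) (jvec a b E L)‖
        + |F - E0| * ‖Matrix.toEuclideanLin (AL a b E0 L) (jvec a b F L)‖ := by
    rw [hd]
    refine (norm_sub_le _ _).trans (le_of_eq ?_)
    rw [norm_smul, norm_smul, Complex.norm_real, Complex.norm_real, Real.norm_eq_abs,
      Real.norm_eq_abs]
  generalize matOpNorm (AL a b E0 L) = N at *
  generalize ‖Matrix.toEuclideanLin (AL a b E0 L) (jvec a b E L)‖ = x at *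
  generalize ‖Matrix.toEuclideanLin (AL a b E0 L) (jvec a b F L)‖ = y at *
  generalize hD : ‖jvec a b E L - jvec a b F L‖ = D at *
  have hD0 : 0 ≤ D := hD ▸ norm_nonneg _
  generalize ‖jvec a b E L‖ = p at *
  generalize ‖jvec a b F L‖ = q at *
  have hpD : p ≤ D := by nlinarith
  have hqD : q ≤ D := by nlinarith
  have e1 : |E - E0| * x ≤ |E - E0| * (N * D) :=
    mul_le_mul_of_nonneg_left (b1.trans (mul_le_mul_of_nonneg_left hpD hN)) (abs_nonneg _)
  have e2 : |F - E0| * y ≤ |F - E0| * (N * D) :=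
    mul_le_mul_of_nonneg_left (b2.trans (mul_le_mul_of_nonneg_left hqD hN)) (abs_nonneg _)
  have hDp : 0 < D := hp.trans_le hpD
  refine le_of_mul_le_mul_right ?_ hDp
  linarith

theorem stmt_0 (a b : ℕ → ℝ) (ha : ∀ n, 0 < a n) (ha0 : a 0 = 1)
    (E0 : ℝ) (L : ℕ) (hL : 1 ≤ L) :
    (∀ E' E'' : ℝ, E' ≠ E'' → orthoP a b L E' = 0 → orthoP a b L E'' = 0 →
      1 ≤ (|E' - E0| + |E'' - E0|) * matOpNorm (AL a b E0 L)) ∧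
    (∀ z1 zm1 : ℝ,
      IsLeast {x : ℝ | orthoP a b L x = 0 ∧ E0 < x} z1 →
      IsGreatest {x : ℝ | orthoP a b L x = 0 ∧ x ≤ E0} zm1 →
      1 ≤ (z1 - zm1) * matOpNorm (AL a b E0 L)) := by
  refine ⟨fun E F hne hE hF => jac_main a b ha ha0 E0 L hL E F hne hE hF, ?_⟩
  rintro z1 zm1 ⟨⟨h1, h2⟩, -⟩ ⟨⟨h3, h4⟩, -⟩
  have h := jac_main a b ha ha0 E0 L hL z1 zm1 (by intro h; linarith) h1 h3
  rw [abs_of_pos (sub_pos.2 h2), abs_of_nonpos (sub_nonpos.2 h4)] at h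
  convert h using 2
  ring
end

section
/- Let L ≥ 2 and let J be the L×L real symmetric tridiagonal (Jacobi) matrix with diagonal entries b_1, …, b_L and off-diagonal entries a_1, …, a_{L−1} > 0. Set α_− = min(1, min_{1≤n≤L−1} a_n), α_+ = max(1, max_{1≤n≤L−1} a_n), β = max_{1≤n≤L} b_n − min_{1≤n≤L} b_n, and γ = α_−^{−1}·((β + 2α_+)² + α_+² + 1)^{1/2}. Then any two distinct eigenvalues E, E′ of J satisfy |E − E′| ≥ (γ² − 1)/(γ^{2L} − 1). -/
open scoped BigOperators

/-- The `L × L` Jacobi matrix with diagonal entries `b 1, …, b L` and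
off-diagonal entries `a 1, …, a (L-1)`. -/
def jacobiMatrix (L : ℕ) (a b : ℕ → ℝ) : Matrix (Fin L) (Fin L) ℝ :=
  Matrix.of fun i j =>
    if (i : ℕ) = (j : ℕ) then b ((i : ℕ) + 1)
    else if (i : ℕ) + 1 = (j : ℕ) then a ((i : ℕ) + 1)
    else if (j : ℕ) + 1 = (i : ℕ) then a ((j : ℕ) + 1)
    else 0


lemma jac_rec_s1 (L : ℕ) (a b : ℕ → ℝ) (E : ℝ) (v : Fin L → ℝ)
    (hv : (jacobiMatrix L a b).mulVec v = E • v) (V : ℕ → ℝ)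
    (hV : ∀ i : Fin L, V i = v i) (hV' : ∀ i, L ≤ i → V i = 0) :
    (∀ i, i < L → b (i+1) * V i + a (i+1) * V (i+1) +
      (if i = 0 then 0 else a i * V (i-1)) = E * V i) := by
  intro i hi
  have h := congrFun hv ⟨i, hi⟩
  simp only [Matrix.mulVec, dotProduct, jacobiMatrix, Matrix.of_apply, Pi.smul_apply,
    smul_eq_mul, ← hV] at h
  rw [← h, Finset.sum_fin_eq_sum_range]
  have : ∀ j ∈ Finset.range L, (if h : j < L then (if i = j then b (i + 1) else if i + 1 = j then a (i + 1)
      else if j + 1 = i then a (j+1) else 0) * V j else 0)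
      = (if i = j then b (i+1) * V i else 0) + (if i + 1 = j then a (i+1) * V (i+1) else 0)
        + (if i - 1 = j then (if i = 0 then 0 else a i * V (i-1)) else 0) := by
    intro j hj
    have hj : j < L := Finset.mem_range.mp hj
    rw [dif_pos hj]
    by_cases h1 : i = j
    · subst h1
      by_cases h0 : i = 0
      · simp [h0]
      · simp [h0]
        intro h2; omega
    · by_cases h2 : i + 1 = j
      · subst h2
        have : ¬ (i - 1 = i + 1) := by omega
        simp [this]
      · by_cases h3 : j + 1 = i
        · subst h3
          simp [show ¬ (j + 1 + 1 = j) by omega]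
        · have : i - 1 = j → i = 0 := by omega
          by_cases h4 : i - 1 = j
          · exact absurd (this h4) (by omega)
          · simp [h1, h2, h3, h4]
  rw [Finset.sum_congr rfl this, Finset.sum_add_distrib, Finset.sum_add_distrib,
    Finset.sum_ite_eq, Finset.sum_ite_eq, Finset.sum_ite_eq,
    if_pos (Finset.mem_range.mpr hi), if_pos (Finset.mem_range.mpr (show i - 1 < L by omega))]
  by_cases h5 : i + 1 < L
  · rw [if_pos (Finset.mem_range.mpr h5)]
  · rw [hV' (i+1) (by omega)]; simp

lemma jac_orth (L : ℕ) (a b : ℕ → ℝ) (E E' : ℝ) (hne : E ≠ E') (u v : Fin L → ℝ)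
    (hu : (jacobiMatrix L a b).mulVec u = E • u)
    (hv : (jacobiMatrix L a b).mulVec v = E' • v) : ∑ i, u i * v i = 0 := by
  have hs : (jacobiMatrix L a b).transpose = jacobiMatrix L a b := by
    ext i j
    simp only [jacobiMatrix, Matrix.transpose_apply, Matrix.of_apply]
    split_ifs <;> first | rfl | omega | (congr 1; omega)
  have h1 : dotProduct u ((jacobiMatrix L a b).mulVec v)
      = dotProduct ((jacobiMatrix L a b).mulVec u) v := by
    rw [Matrix.dotProduct_mulVec, ← Matrix.mulVec_transpose, hs]
  rw [hu, hv, dotProduct_smul, smul_dotProduct, smul_eq_mul, smul_eq_mul] at h1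
  have : (E - E') * dotProduct u v = 0 := by linarith
  exact (mul_eq_zero.mp this).resolve_left (sub_ne_zero.mpr hne)

lemma jac_first (L : ℕ) (hL : 0 < L) (a b : ℕ → ℝ) (E : ℝ) (v : Fin L → ℝ)
    (ha : ∀ n, 1 ≤ n → n ≤ L - 1 → 0 < a n) (hv0 : v ≠ 0)
    (hv : (jacobiMatrix L a b).mulVec v = E • v) : v ⟨0, hL⟩ ≠ 0 := by
  intro h0
  set V : ℕ → ℝ := fun i => if h : i < L then v ⟨i, h⟩ else 0 with hVd
  have hV : ∀ i : Fin L, V i = v i := fun i => by simp [V]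
  have hr := jac_rec_s1 L a b E v hv V hV (fun i hi => by simp [V, hi])
  have key : ∀ i, V i = 0 ∧ V (i+1) = 0 := by
    have z : V 0 = 0 := by simp [V, h0]
    have step : ∀ i, V i = 0 → (i = 0 ∨ V (i-1) = 0) → V (i+1) = 0 := by
      intro i h1 h2
      by_cases h : i + 1 < L
      · have := hr i (by omega)
        have hp := ha (i+1) (by omega) (by omega)
        have h3 : (if i = 0 then 0 else a i * V (i-1)) = 0 := by
          split_ifs with h4
          · rfl
          · rw [h2.resolve_left h4, mul_zero]
        rw [h1, h3] at this
        have h5 : a (i+1) * V (i+1) = 0 := by linarith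
        exact (mul_eq_zero.mp h5).resolve_left hp.ne'
      · simp [V, h]
    intro i
    induction i with
    | zero => exact ⟨z, step 0 z (Or.inl rfl)⟩
    | succ n ih => exact ⟨ih.2, step (n+1) ih.2 (Or.inr ih.1)⟩
  exact hv0 (funext fun i => by rw [← hV]; exact (key i).1)

set_option maxHeartbeats 1000000 in
lemma jac_gap (L : ℕ) (hL : 0 < L) (a b : ℕ → ℝ) (E E' : ℝ) (hne : E ≠ E')
    (αm αp c g : ℝ) (hm : 0 < αm) (hp : 0 ≤ αp) (hc : 0 ≤ c) (hg : 1 ≤ αm * g) (hg1 : 1 ≤ g)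
    (hg2 : c + αp + 1 ≤ αm * g)
    (ham : ∀ n, 1 ≤ n → n ≤ L - 1 → αm ≤ a n)
    (hap : ∀ n, 1 ≤ n → n ≤ L - 1 → a n ≤ αp)
    (hcb : ∀ n, 1 ≤ n → n ≤ L → |E - b n| ≤ c)
    (u v : Fin L → ℝ) (hu : (jacobiMatrix L a b).mulVec u = E • u)
    (hv : (jacobiMatrix L a b).mulVec v = E' • v)
    (h0 : u ⟨0, hL⟩ = v ⟨0, hL⟩) (hv0 : v ⟨0, hL⟩ ≠ 0) :
    1 ≤ |E - E'| * ∑ i ∈ Finset.range L, g ^ i := by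
  set δ := |E - E'| with hδ
  have hδ0 : 0 ≤ δ := abs_nonneg _
  set U : ℕ → ℝ := fun i => if h : i < L then u ⟨i, h⟩ else 0 with hUd
  have hU : ∀ i : Fin L, U i = u i := fun i => by simp [U]
  have hru := jac_rec_s1 L a b E u hu U hU (fun i hi => by simp [U, hi])
  set V : ℕ → ℝ := fun i => if h : i < L then v ⟨i, h⟩ else 0 with hVd
  have hV : ∀ i : Fin L, V i = v i := fun i => by simp [V]
  have hrv := jac_rec_s1 L a b E' v hv V hV (fun i hi => by simp [V, hi])
  obtain ⟨k, -, hk⟩ := Finset.exists_max_image (Finset.univ : Finset (Fin L)) (fun i => |v i|)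
    ⟨⟨0, hL⟩, Finset.mem_univ _⟩
  set M := |v k| with hM
  have hM0 : 0 < M := lt_of_lt_of_le (abs_pos.mpr hv0) (hk _ (Finset.mem_univ _))
  have hVM : ∀ i, |V i| ≤ M := by
    intro i
    by_cases h : i < L
    · simpa [V, h] using hk ⟨i, h⟩ (Finset.mem_univ _)
    · simp [V, h, hM0.le]
  have hDM : 0 ≤ δ * M := by positivity
  have hW0 : U 0 - V 0 = 0 := by simp [U, V, hL, h0]
  have key : ∀ i, |U i - V i| ≤ δ * M * g ^ i ∧ |U (i+1) - V (i+1)| ≤ δ * M * g ^ (i+1) := by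
    intro i
    induction i with
    | zero =>
      refine ⟨by rw [hW0]; simpa using hDM, ?_⟩
      by_cases h : 1 < L
      · have e1 := hru 0 hL
        have e2 := hrv 0 hL
        simp only [if_true, zero_add] at e1 e2
        have e3 : a 1 * (U 1 - V 1) = (E - E') * V 0 := by
          have : U 0 = V 0 := by linarith
          rw [this] at e1
          linarith
        have e4 : a 1 * |U 1 - V 1| ≤ δ * M := by
          have h1 := ham 1 le_rfl (by omega)
          rw [← abs_of_pos (lt_of_lt_of_le hm h1), ← abs_mul, e3, abs_mul]
          exact mul_le_mul_of_nonneg_left (hVM 0) hδ0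
        have h1 := ham 1 le_rfl (by omega)
        have e5 : αm * |U 1 - V 1| ≤ αm * (δ * M * g) := by
          nlinarith [abs_nonneg (U 1 - V 1)]
        simpa using le_of_mul_le_mul_left e5 hm
      · simp only [zero_add]
        simp only [U, V, h]
        simp; positivity
    | succ n ih =>
      refine ⟨ih.2, ?_⟩
      by_cases h : n + 1 + 1 < L
      · have e1 := hru (n+1) (by omega)
        have e2 := hrv (n+1) (by omega)
        simp only [Nat.add_eq_zero_iff, one_ne_zero, and_false, if_false, Nat.add_sub_cancel] at e1 e2
        have h1 := ham (n+1+1) (by omega) (by omega)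
        have h2 := ham (n+1) (by omega) (by omega)
        have h3 := hap (n+1) (by omega) (by omega)
        have h4 := hcb (n+1+1) (by omega) (by omega)
        have e3 : a (n+1+1) * (U (n+1+1) - V (n+1+1)) = (E - b (n+1+1)) * (U (n+1) - V (n+1))
            + (- (a (n+1) * (U n - V n))) + (E - E') * V (n+1) := by linarith
        have e4 : a (n+1+1) * |U (n+1+1) - V (n+1+1)| ≤ c * (δ * M * g ^ (n+1))
            + αp * (δ * M * g ^ n) + δ * M := by
          rw [← abs_of_pos (lt_of_lt_of_le hm h1), ← abs_mul, e3]
          refine (abs_add_three _ _ _).trans ?_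
          rw [abs_neg, abs_mul, abs_mul, abs_mul, abs_of_pos (lt_of_lt_of_le hm h2)]
          exact add_le_add (add_le_add (mul_le_mul h4 ih.2 (abs_nonneg _) hc)
            (mul_le_mul h3 ih.1 (abs_nonneg _) hp)) (mul_le_mul_of_nonneg_left (hVM _) hδ0)
        have g1 : 1 ≤ g ^ (n+1) := one_le_pow₀ hg1
        have g2 : g ^ n ≤ g ^ (n+1) := pow_le_pow_right₀ hg1 (Nat.le_succ n)
        have e5 : c * (δ * M * g ^ (n+1)) + αp * (δ * M * g ^ n) + δ * M
            ≤ (δ * M) * ((c + αp + 1) * g ^ (n+1)) := by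
          have : αp * g ^ n ≤ αp * g ^ (n+1) := mul_le_mul_of_nonneg_left g2 hp
          have := mul_le_mul_of_nonneg_left (add_le_add this g1) hDM
          linarith
        have e6 : (δ * M) * ((c + αp + 1) * g ^ (n+1)) ≤ αm * (δ * M * g ^ (n+1+1)) := by
          have := mul_le_mul_of_nonneg_left
            (mul_le_mul_of_nonneg_right hg2 (zero_le_one.trans g1)) hDM
          calc _ ≤ _ := this
            _ = _ := by ring
        have e7 := mul_le_mul_of_nonneg_right h1 (abs_nonneg (U (n+1+1) - V (n+1+1)))
        exact le_of_mul_le_mul_left (by linarith) hm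
      · simp only [U, V, h]
        simp; positivity
  set G := ∑ i ∈ Finset.range L, g ^ i with hG
  have s1 : ∑ i : Fin L, (u i - v i) ^ 2 ≤ (δ * M * G) ^ 2 := by
    calc ∑ i : Fin L, (u i - v i) ^ 2 ≤ ∑ i : Fin L, (δ * M * g ^ (i:ℕ)) ^ 2 := by
          refine Finset.sum_le_sum fun i _ => ?_
          rw [← hU, ← hV]
          exact sq_le_sq' (by linarith [neg_abs_le (U i - V i), (key i).1])
            ((le_abs_self _).trans (key i).1)
      _ ≤ (∑ i : Fin L, (δ * M * g ^ (i:ℕ))) ^ 2 :=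
          Finset.sum_sq_le_sq_sum_of_nonneg (fun i _ => by positivity)
      _ = _ := by rw [← Finset.mul_sum, hG, Finset.sum_range]
  have s2 : ∑ i : Fin L, (u i - v i) ^ 2 = ∑ i, (u i) ^ 2 + ∑ i, (v i)^2 := by
    have := jac_orth L a b E E' hne u v hu hv
    have h2 : ∑ i : Fin L, (u i - v i) ^ 2 = ∑ i, (u i) ^ 2 + ∑ i, (v i)^2 - 2 * ∑ i, u i * v i := by
      rw [Finset.mul_sum, ← Finset.sum_add_distrib, ← Finset.sum_sub_distrib]
      exact Finset.sum_congr rfl fun i _ => by ring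
    rw [h2, this]; ring
  have s3 : M ^ 2 ≤ ∑ i, (v i)^2 := by
    rw [hM, sq_abs]
    exact Finset.single_le_sum (f := fun i => (v i)^2) (fun i _ => sq_nonneg _) (Finset.mem_univ k)
  have s4 : 0 ≤ ∑ i, (u i)^2 := Finset.sum_nonneg fun i _ => sq_nonneg _
  have hG0 : 0 ≤ G := Finset.sum_nonneg fun i _ => by positivity
  have s5 : M ≤ δ * M * G := by
    exact le_of_sq_le_sq (by linarith only [s1, s2, s3, s4]) (mul_nonneg hDM hG0)
  have : M * 1 ≤ M * (δ * G) := by linarith only [s5]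
  exact le_of_mul_le_mul_left this hM0

lemma jac_gersh (L : ℕ) (hL : 0 < L) (a b : ℕ → ℝ) (E αp : ℝ)
    (ha : ∀ n, 1 ≤ n → n ≤ L - 1 → 0 < a n) (hp : 0 ≤ αp)
    (hap : ∀ n, 1 ≤ n → n ≤ L - 1 → a n ≤ αp)
    (v : Fin L → ℝ) (hv : (jacobiMatrix L a b).mulVec v = E • v)
    (hv0 : v ⟨0, hL⟩ ≠ 0) : ∃ k, 1 ≤ k ∧ k ≤ L ∧ |E - b k| ≤ 2 * αp := by
  set V : ℕ → ℝ := fun i => if h : i < L then v ⟨i, h⟩ else 0 with hVd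
  have hV : ∀ i : Fin L, V i = v i := fun i => by simp [V]
  have hrv := jac_rec_s1 L a b E v hv V hV (fun i hi => by simp [V, hi])
  obtain ⟨k, -, hk⟩ := Finset.exists_max_image (Finset.univ : Finset (Fin L)) (fun i => |v i|)
    ⟨⟨0, hL⟩, Finset.mem_univ _⟩
  have hM0 : 0 < |v k| := lt_of_lt_of_le (abs_pos.mpr hv0) (hk _ (Finset.mem_univ _))
  have hVM : ∀ i, |V i| ≤ |v k| := by
    intro i
    by_cases h : i < L
    · simpa [V, h] using hk ⟨i, h⟩ (Finset.mem_univ _)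
    · simp [V, h]
  refine ⟨k + 1, by omega, k.2, ?_⟩
  have e := hrv k k.2
  have h1 : |a (k+1) * V (k+1)| ≤ αp * |v k| := by
    by_cases h : (k:ℕ) + 1 < L
    · rw [abs_mul, abs_of_pos (ha (k+1) (by omega) (by omega))]
      exact mul_le_mul (hap _ (by omega) (by omega)) (hVM _) (abs_nonneg _) hp
    · simp only [V, h]; simp; positivity
  have h2 : |(if (k:ℕ) = 0 then 0 else a k * V (k-1))| ≤ αp * |v k| := by
    split_ifs with h
    · simp; positivity
    · have := k.2
      rw [abs_mul, abs_of_pos (ha k (by omega) (by omega))]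
      exact mul_le_mul (hap _ (by omega) (by omega)) (hVM _) (abs_nonneg _) hp
  have h3 : (E - b (k+1)) * v k = a (k+1) * V (k+1) + (if (k:ℕ) = 0 then 0 else a k * V (k-1)) := by
    rw [← hV]; linarith
  have h4 : |E - b (k+1)| * |v k| ≤ 2 * αp * |v k| := by
    rw [← abs_mul, h3]
    exact (abs_add_le _ _).trans (by linarith)
  exact le_of_mul_le_mul_right h4 hM0

theorem stmt_1 (L : ℕ) (hL : 2 ≤ L) (a b : ℕ → ℝ)
    (ha : ∀ n, 1 ≤ n → n ≤ L - 1 → 0 < a n)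
    (αm αp β γ : ℝ)
    (hαm : αm = min 1 ((Finset.Icc 1 (L - 1)).inf' (Finset.nonempty_Icc.mpr (by omega)) a))
    (hαp : αp = max 1 ((Finset.Icc 1 (L - 1)).sup' (Finset.nonempty_Icc.mpr (by omega)) a))
    (hβ : β = (Finset.Icc 1 L).sup' (Finset.nonempty_Icc.mpr (by omega)) b
            - (Finset.Icc 1 L).inf' (Finset.nonempty_Icc.mpr (by omega)) b)
    (hγ : γ = αm⁻¹ * Real.sqrt ((β + 2 * αp) ^ 2 + αp ^ 2 + 1))
    (E E' : ℝ) (hEE' : E ≠ E')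
    (hE : ∃ v : Fin L → ℝ, v ≠ 0 ∧ (jacobiMatrix L a b).mulVec v = E • v)
    (hE' : ∃ v : Fin L → ℝ, v ≠ 0 ∧ (jacobiMatrix L a b).mulVec v = E' • v) :
    (γ ^ 2 - 1) / (γ ^ (2 * L) - 1) ≤ |E - E'| := by
  have hL0 : 0 < L := by omega
  obtain ⟨u, hu0, hu⟩ := hE
  obtain ⟨v, hv0, hv⟩ := hE'
  have hu1 := jac_first L hL0 a b E u ha hu0 hu
  have hv1 := jac_first L hL0 a b E' v ha hv0 hv
  have hm0 : 0 < αm := by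
    rw [hαm]
    refine lt_min one_pos ((Finset.lt_inf'_iff _).mpr fun n hn => ?_)
    rw [Finset.mem_Icc] at hn
    exact ha n hn.1 hn.2
  have hm1 : αm ≤ 1 := hαm ▸ min_le_left _ _
  have hp1 : 1 ≤ αp := hαp ▸ le_max_left _ _
  have ham : ∀ n, 1 ≤ n → n ≤ L - 1 → αm ≤ a n := fun n h1 h2 => by
    rw [hαm]
    exact (min_le_right _ _).trans (Finset.inf'_le _ (Finset.mem_Icc.mpr ⟨h1, h2⟩))
  have hap : ∀ n, 1 ≤ n → n ≤ L - 1 → a n ≤ αp := fun n h1 h2 => by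
    rw [hαp]
    exact (Finset.le_sup' a (Finset.mem_Icc.mpr ⟨h1, h2⟩)).trans (le_max_right _ _)
  have hb : ∀ m n, 1 ≤ m → m ≤ L → 1 ≤ n → n ≤ L → b m - b n ≤ β := fun m n h1 h2 h3 h4 => by
    rw [hβ]
    exact sub_le_sub (Finset.le_sup' b (Finset.mem_Icc.mpr ⟨h1, h2⟩))
      (Finset.inf'_le b (Finset.mem_Icc.mpr ⟨h3, h4⟩))
  have hβ0 : 0 ≤ β := by simpa using hb 1 1 le_rfl (by omega) le_rfl (by omega)
  obtain ⟨k, hk1, hk2, hk⟩ := jac_gersh L hL0 a b E αp ha (by linarith) hap u hu hu1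
  have hcb : ∀ n, 1 ≤ n → n ≤ L → |E - b n| ≤ β + 2 * αp := fun n h1 h2 => by
    have q1 := hb k n hk1 hk2 h1 h2
    have q2 := hb n k h1 h2 hk1 hk2
    rw [abs_le] at hk ⊢
    constructor <;> linarith [hk.1, hk.2]
  have hg : γ ^ 2 * αm ^ 2 = (β + 2 * αp) ^ 2 + αp ^ 2 + 1 := by
    rw [hγ, mul_pow, Real.sq_sqrt (by positivity)]
    field_simp
  have hc : 2 ≤ β + 2 * αp := by linarith
  have hg2 : (β + 2 * αp) ^ 2 + αp ^ 2 + 1 ≤ αm * γ ^ 2 := by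
    rw [← hg]
    nlinarith [mul_nonneg (sq_nonneg γ) (mul_nonneg hm0.le (sub_nonneg.mpr hm1))]
  have hg3 : β + 2 * αp + αp + 1 ≤ αm * γ ^ 2 := by nlinarith
  have hg4 : αm * γ ^ 2 ≤ γ ^ 2 := by nlinarith [sq_nonneg γ]
  have hg1 : 1 < γ ^ 2 := by linarith
  have main := jac_gap L hL0 a b E E' hEE' αm αp (β + 2 * αp) (γ ^ 2) hm0 (by linarith)
    (by linarith) (by linarith) hg1.le hg3 ham hap hcb
    ((u ⟨0, hL0⟩)⁻¹ • u) ((v ⟨0, hL0⟩)⁻¹ • v)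
    (by rw [Matrix.mulVec_smul, hu, smul_comm]) (by rw [Matrix.mulVec_smul, hv, smul_comm])
    (by simp [hu1, hv1]) (by simp [hv1])
  have hge := geom_sum_mul (γ ^ 2) L
  rw [pow_mul, ← hge]
  have hGp : 0 < ∑ i ∈ Finset.range L, (γ ^ 2) ^ i := by
    by_contra hcon
    nlinarith [abs_nonneg (E - E')]
  rw [div_le_iff₀ (mul_pos hGp (by linarith))]
  nlinarith
end

section
/- For every p ∈ (0, ∞) there is a constant D_p > 0 such that for every integer n ≥ 1 and every real polynomial π of degree at most n, ∫_{−1}^{1} |π(x)|^p dx ≥ D_p·n^{−1}·|π(0)|^p. -/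
open MeasureTheory

lemma aux_growth (P : Polynomial ℂ) (N : ℕ) (hN : P.natDegree ≤ N) (M : ℝ)
    (h : ∀ z : ℂ, ‖z‖ = 1 → ‖P.eval z‖ ≤ M) (z : ℂ) (hz : ‖z‖ ≤ 1) : ‖P.eval z‖ ≤ M := by
  refine Complex.norm_le_of_forall_mem_frontier_norm_le (f := fun z => P.eval z)
    (U := Metric.ball (0:ℂ) 1) Metric.isBounded_ball ?_ ?_ ?_
  · exact (Polynomial.differentiable P).diffContOnCl
  · intro w hw
    rw [frontier_ball _ one_ne_zero] at hw
    exact h w (by simpa using hw)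
  · rw [closure_ball _ one_ne_zero]
    simpa using hz

lemma aux_growth2 (P : Polynomial ℂ) (N : ℕ) (hN : P.natDegree ≤ N) (M : ℝ)
    (h : ∀ z : ℂ, ‖z‖ = 1 → ‖P.eval z‖ ≤ M) (z : ℂ) (hz : 1 ≤ ‖z‖) :
    ‖P.eval z‖ ≤ M * ‖z‖ ^ N := by
  have key : ∀ w : ℂ, w ≠ 0 → ‖(P.reflect N).eval w⁻¹‖ * ‖w‖ ^ N = ‖P.eval w‖ := by
    intro w hw
    haveI := invertibleOfNonzero hw
    have := Polynomial.eval₂_reflect_mul_pow (RingHom.id ℂ) w N P hN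
    rw [Polynomial.eval₂_id, Polynomial.eval₂_id, invOf_eq_inv] at this
    rw [← this, norm_mul, norm_pow]
  have hz0 : z ≠ 0 := by
    rintro rfl
    simp at hz
    linarith
  rw [← key z hz0]
  gcongr
  refine aux_growth _ _ le_rfl M ?_ _ ?_
  · intro w hw
    have hw0 : w ≠ 0 := by
      rintro rfl
      simp at hw
    have h1 := key w⁻¹ (inv_ne_zero hw0)
    rw [inv_inv, norm_inv, hw] at h1
    simp at h1
    rw [h1]
    exact h _ (by simp [hw])
  · rw [norm_inv]
    exact inv_le_one_of_one_le₀ hz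

lemma aux_bern (P : Polynomial ℂ) (N : ℕ) (hN : P.natDegree ≤ N) (hN1 : 1 ≤ N) (M : ℝ)
    (h : ∀ z : ℂ, ‖z‖ = 1 → ‖P.eval z‖ ≤ M) (z : ℂ) (hz : ‖z‖ = 1) :
    ‖P.derivative.eval z‖ ≤ 3 * N * M := by
  have hM : 0 ≤ M := (norm_nonneg _).trans (h z hz)
  have hNpos : (0:ℝ) < N := by exact_mod_cast hN1
  have hpow : (1 + (N:ℝ)⁻¹) ^ N ≤ 3 := by
    have h1 : (1 + (N:ℝ)⁻¹) ^ N ≤ (Real.exp ((N:ℝ)⁻¹)) ^ N := by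
      gcongr
      linarith [Real.add_one_le_exp ((N:ℝ)⁻¹)]
    rw [← Real.exp_nat_mul, mul_inv_cancel₀ hNpos.ne'] at h1
    linarith [Real.exp_one_lt_d9]
  have := Complex.norm_deriv_le_of_forall_mem_sphere_norm_le (c := z) (R := (N:ℝ)⁻¹)
    (C := 3 * M) (f := fun z => P.eval z) (by positivity)
    (Polynomial.differentiable P).diffContOnCl ?_
  · rw [Polynomial.deriv] at this
    calc _ ≤ _ := this
      _ = _ := by field_simp
  · intro w hw
    have hw' : ‖w‖ ≤ 1 + (N:ℝ)⁻¹ := by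
      have : ‖w - z‖ = (N:ℝ)⁻¹ := by simpa [dist_eq_norm] using hw
      have h2 := norm_add_le (w - z) z
      rw [sub_add_cancel] at h2
      linarith
    rcases le_total ‖w‖ 1 with h1 | h1
    · have := aux_growth P N hN M h w h1
      linarith
    · have := aux_growth2 P N hN M h w h1
      have h3 : ‖w‖ ^ N ≤ 3 := (pow_le_pow_left₀ (norm_nonneg _) hw' N).trans hpow
      nlinarith

lemma aux_poly (Q : Polynomial ℝ) (n k : ℕ) (hn : Q.natDegree ≤ n) :
    ∃ P : Polynomial ℂ, P.natDegree ≤ 2 * (n + k) ∧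
      ∀ z : ℂ, ‖z‖ = 1 → ‖P.eval z‖ = |Q.eval z.im| * |z.re| ^ k := by
  refine ⟨(∑ j ∈ Finset.range (n+1), Polynomial.C ((Q.coeff j : ℝ) : ℂ) *
    (Polynomial.C (1 / (2 * Complex.I)) * (Polynomial.X ^ 2 - 1)) ^ j * Polynomial.X ^ (n - j)) *
    (Polynomial.C (1/2) * (Polynomial.X ^ 2 + 1)) ^ k, ?_, ?_⟩
  · have h2 : ((Polynomial.C (1/2) * (Polynomial.X ^ 2 + 1)) ^ k : Polynomial ℂ).natDegree
        ≤ k * 2 := by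
      refine Polynomial.natDegree_pow_le_of_le k ?_
      compute_degree
    refine Polynomial.natDegree_mul_le.trans ?_
    have h1 : (∑ j ∈ Finset.range (n+1), Polynomial.C ((Q.coeff j : ℝ) : ℂ) *
        (Polynomial.C (1 / (2 * Complex.I)) * (Polynomial.X ^ 2 - 1)) ^ j *
        Polynomial.X ^ (n - j)).natDegree ≤ 2 * n := by
      refine Polynomial.natDegree_sum_le_of_forall_le _ _ ?_
      intro j hj
      have hj' : j ≤ n := by simpa [Nat.lt_succ_iff] using hj
      have h3 : ((Polynomial.C (1 / (2 * Complex.I)) * (Polynomial.X ^ 2 - 1)) ^ j :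
          Polynomial ℂ).natDegree ≤ j * 2 := by
        refine Polynomial.natDegree_pow_le_of_le j ?_
        compute_degree
      refine Polynomial.natDegree_mul_le.trans ?_
      have h4 := Polynomial.natDegree_C_mul_le ((Q.coeff j : ℝ) : ℂ)
        ((Polynomial.C (1 / (2 * Complex.I)) * (Polynomial.X ^ 2 - 1)) ^ j)
      rw [Polynomial.natDegree_X_pow]
      omega
    omega
  · intro z hz
    have hzz : z * (starRingEnd ℂ) z = 1 := by
      rw [Complex.mul_conj, Complex.normSq_eq_norm_sq, hz]; simp
    have hs : z ^ 2 - 1 = 2 * Complex.I * (z * (z.im : ℂ)) := by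
      rw [← hzz]
      have := Complex.sub_conj z
      push_cast at this
      linear_combination z * this
    have hc : z ^ 2 + 1 = 2 * (z * (z.re : ℂ)) := by
      rw [← hzz]
      have := Complex.add_conj z
      push_cast at this
      linear_combination z * this
    have e1 : ∀ j ∈ Finset.range (n+1), ((Q.coeff j : ℝ) : ℂ) *
        (1 / (2 * Complex.I) * (z ^ 2 - 1)) ^ j * z ^ (n - j)
        = z ^ n * ((Q.coeff j * z.im ^ j : ℝ) : ℂ) := by
      intro j hj
      have hj' : j ≤ n := by simpa [Nat.lt_succ_iff] using hj
      have : 1 / (2 * Complex.I) * (z ^ 2 - 1) = z * (z.im : ℂ) := by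
        rw [hs]; field_simp
      rw [this, mul_pow]
      have h5 : z ^ n = z ^ j * z ^ (n - j) := by rw [← pow_add]; congr 1; omega
      rw [h5]; push_cast; ring
    have e2 : (1 / 2 : ℂ) * (z ^ 2 + 1) = z * (z.re : ℂ) := by rw [hc]; ring
    rw [Polynomial.eval_mul, Polynomial.eval_finset_sum]
    simp only [Polynomial.eval_mul, Polynomial.eval_pow, Polynomial.eval_C, Polynomial.eval_X,
      Polynomial.eval_sub, Polynomial.eval_add, Polynomial.eval_one]
    rw [Finset.sum_congr rfl e1, ← Finset.mul_sum, ← Complex.ofReal_sum,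
      ← Polynomial.eval_eq_sum_range' (Nat.lt_succ_of_le hn), e2]
    simp [hz]

lemma aux_max (Q : Polynomial ℝ) (n k : ℕ) (hn1 : 1 ≤ n) (hk : 1 ≤ k) (hn : Q.natDegree ≤ n) :
    ∃ t ∈ Set.Icc (-(Real.pi/2)) (Real.pi/2), ∀ s : ℝ, |s - t| ≤ 1 / (12 * (n + k)) →
      |Q.eval 0| / 2 ≤ |Q.eval (Real.sin s)| * |Real.cos s| ^ k := by
  obtain ⟨P, hPd, hP⟩ := aux_poly Q n k hn
  obtain ⟨t, ht, hmax⟩ := (isCompact_Icc (a := -(Real.pi/2)) (b := Real.pi/2)).exists_isMaxOn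
    (f := fun s => |Q.eval (Real.sin s)| * |Real.cos s| ^ k)
    ⟨0, by constructor <;> linarith [Real.pi_pos]⟩ (by fun_prop)
  refine ⟨t, ht, ?_⟩
  set M := |Q.eval (Real.sin t)| * |Real.cos t| ^ k with hM
  have hmax' : ∀ s ∈ Set.Icc (-(Real.pi/2)) (Real.pi/2),
    |Q.eval (Real.sin s)| * |Real.cos s| ^ k ≤ M := fun s hs => hmax hs
  have hM0 : |Q.eval 0| ≤ M := by
    simpa using hmax' 0 (by constructor <;> linarith [Real.pi_pos])
  have hMn : 0 ≤ M := (abs_nonneg _).trans hM0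
  have hbd : ∀ z : ℂ, ‖z‖ = 1 → ‖P.eval z‖ ≤ M := by
    intro z hz
    rw [hP z hz]
    have hy : |z.im| ≤ 1 := hz ▸ Complex.abs_im_le_norm z
    have := hmax' (Real.arcsin z.im) (Real.arcsin_mem_Icc _)
    rw [Real.sin_arcsin (abs_le.1 hy).1 (abs_le.1 hy).2, Real.cos_arcsin] at this
    have h2 : z.re ^ 2 = 1 - z.im ^ 2 := by
      have := Complex.normSq_eq_norm_sq z
      rw [hz, Complex.normSq_apply] at this
      linarith
    rw [← h2, Real.sqrt_sq_eq_abs, abs_abs] at this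
    exact this
  have hbern := aux_bern P (2 * (n + k)) hPd (by omega) M hbd
  have hexp : ∀ s : ℝ, ‖Complex.exp (s * Complex.I)‖ = 1 := Complex.norm_exp_ofReal_mul_I
  have hval : ∀ s : ℝ, ‖P.eval (Complex.exp (s * Complex.I))‖
      = |Q.eval (Real.sin s)| * |Real.cos s| ^ k := by
    intro s
    rw [hP _ (hexp s), Complex.exp_ofReal_mul_I_im, Complex.exp_ofReal_mul_I_re]
  have hder : ∀ s : ℝ, HasDerivAt (fun s : ℝ => P.eval (Complex.exp (s * Complex.I)))
      (P.derivative.eval (Complex.exp (s * Complex.I)) *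
        (Complex.exp (s * Complex.I) * Complex.I)) s := by
    intro s
    have h1 : HasDerivAt (fun s : ℝ => (s : ℂ) * Complex.I) Complex.I s := by
      simpa using (Complex.ofRealCLM.hasDerivAt (x := s)).mul_const Complex.I
    exact (P.hasDerivAt _).comp s h1.cexp
  intro s hs
  have hlip := (convex_univ (𝕜 := ℝ) (E := ℝ)).norm_image_sub_le_of_norm_hasDerivWithin_le
    (f := fun s : ℝ => P.eval (Complex.exp (s * Complex.I))) (C := 3 * (2 * (n + k) : ℕ) * M)
    (fun x _ => (hder x).hasDerivWithinAt) (fun x _ => by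
      rw [norm_mul, norm_mul, hexp]; simpa using hbern _ (hexp x))
    (Set.mem_univ t) (Set.mem_univ s)
  rw [Real.norm_eq_abs] at hlip
  have hnk : (0:ℝ) < n + k := by positivity
  have h3 : 3 * ((2 * (n + k) : ℕ):ℝ) * M * |s - t| ≤ M / 2 := by
    calc _ ≤ 3 * ((2 * (n + k) : ℕ):ℝ) * M * (1 / (12 * (n + k))) := by gcongr
      _ = M / 2 := by push_cast; field_simp; ring
  have h4 := norm_sub_norm_le (P.eval (Complex.exp (t * Complex.I)))
    (P.eval (Complex.exp (s * Complex.I)))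
  rw [norm_sub_rev, hval, hval, ← hM] at h4
  linarith

theorem stmt_13 (p : ℝ) (hp : 0 < p) :
    ∃ D : ℝ, 0 < D ∧ ∀ (n : ℕ), 1 ≤ n → ∀ Q : Polynomial ℝ, Q.natDegree ≤ n →
      D * (n : ℝ)⁻¹ * |Q.eval 0| ^ p ≤
        ∫ x in Set.Icc (-1 : ℝ) 1, |Q.eval x| ^ p ∂volume := by
  obtain ⟨k, hk⟩ := exists_nat_ge (1 / p)
  have hk1 : 1 ≤ k := by
    have : (0:ℝ) < k := lt_of_lt_of_le (by positivity) hk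
    exact_mod_cast this
  have hkp : 1 ≤ (k:ℝ) * p := by rwa [div_le_iff₀ hp] at hk
  refine ⟨(1/2) ^ p * (1 / (12 * (1 + k))), by positivity, ?_⟩
  intro n hn1 Q hn
  obtain ⟨t, ht, hlow⟩ := aux_max Q n k hn1 hk1 hn
  have hn1' : (1:ℝ) ≤ n := by exact_mod_cast hn1
  set δ : ℝ := 1 / (12 * (n + k)) with hδ
  have hδ0 : 0 < δ := by positivity
  have hδ1 : δ ≤ 1 := by
    rw [hδ, div_le_one (by positivity)]
    have : (0:ℝ) ≤ k := by positivity
    linarith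
  have hcont : Continuous (fun x : ℝ => |Q.eval x| ^ p) :=
    (by fun_prop : Continuous (fun x : ℝ => |Q.eval x|)).rpow_const (fun _ => Or.inr hp.le)
  obtain ⟨a, b, hab, ha, hb, hts⟩ : ∃ a b : ℝ, b - a = δ ∧ -(Real.pi/2) ≤ a ∧ b ≤ Real.pi/2 ∧
      ∀ s ∈ Set.Icc a b, |s - t| ≤ δ := by
    rcases le_total t 0 with h | h
    · refine ⟨t, t + δ, by ring, ht.1, by linarith [Real.pi_gt_three], fun s hs => ?_⟩
      rw [abs_le]; constructor <;> linarith [hs.1, hs.2]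
    · refine ⟨t - δ, t, by ring, by linarith [Real.pi_gt_three], ht.2, fun s hs => ?_⟩
      rw [abs_le]; constructor <;> linarith [hs.1, hs.2]
  have hab' : a ≤ b := by linarith
  have hsin : Real.sin a ≤ Real.sin b := Real.sin_le_sin_of_le_of_le_pi_div_two ha hb hab'
  have step1 : ∫ x in (Real.sin a)..(Real.sin b), |Q.eval x| ^ p ≤
      ∫ x in Set.Icc (-1 : ℝ) 1, |Q.eval x| ^ p ∂volume := by
    rw [intervalIntegral.integral_of_le hsin]
    refine setIntegral_mono_set ?_ ?_ ?_
    · exact hcont.continuousOn.integrableOn_Icc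
    · exact Filter.Eventually.of_forall fun x => by positivity
    · refine HasSubset.Subset.eventuallyLE ?_
      intro x hx
      exact ⟨(Real.neg_one_le_sin a).trans hx.1.le, hx.2.trans (Real.sin_le_one b)⟩
  have step2 : ∫ x in a..b, |Q.eval (Real.sin x)| ^ p * Real.cos x =
      ∫ x in (Real.sin a)..(Real.sin b), |Q.eval x| ^ p :=
    intervalIntegral.integral_comp_mul_deriv (f := Real.sin) (f' := Real.cos)
      (g := fun x => |Q.eval x| ^ p)
      (fun x _ => Real.hasDerivAt_sin x) Real.continuous_cos.continuousOn hcont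
  have step3 : ∫ x in a..b, (|Q.eval 0| / 2) ^ p ≤
      ∫ x in a..b, |Q.eval (Real.sin x)| ^ p * Real.cos x := by
    refine intervalIntegral.integral_mono_on hab' (by simp) ?_ ?_
    · exact ((hcont.comp Real.continuous_sin).mul Real.continuous_cos).intervalIntegrable _ _
    · intro x hx
      have hc : 0 ≤ Real.cos x :=
        Real.cos_nonneg_of_mem_Icc ⟨by linarith [hx.1], by linarith [hx.2]⟩
      have h1 := hlow x (hts x hx)
      rw [abs_of_nonneg hc] at h1
      calc (|Q.eval 0| / 2) ^ p ≤ (|Q.eval (Real.sin x)| * Real.cos x ^ k) ^ p := by gcongr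
        _ = |Q.eval (Real.sin x)| ^ p * Real.cos x ^ ((k:ℝ) * p) := by
          rw [Real.mul_rpow (abs_nonneg _) (by positivity), Real.rpow_mul hc, Real.rpow_natCast]
        _ ≤ |Q.eval (Real.sin x)| ^ p * Real.cos x := by
          gcongr
          have := Real.rpow_le_rpow_of_exponent_ge' hc (Real.cos_le_one x) zero_le_one hkp
          rwa [Real.rpow_one] at this
  rw [intervalIntegral.integral_const, hab, smul_eq_mul] at step3
  refine le_trans ?_ (step3.trans (step2.le.trans step1))
  rw [div_eq_mul_one_div |Q.eval 0|, Real.mul_rpow (abs_nonneg _) (by positivity)]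
  have h5 : 1 / (12 * (1 + (k:ℝ))) * (n:ℝ)⁻¹ ≤ δ := by
    rw [hδ, ← one_div, one_div_mul_one_div]
    apply one_div_le_one_div_of_le (by positivity)
    have : (0:ℝ) ≤ k := by positivity
    nlinarith
  calc _ = (1 / (12 * (1 + (k:ℝ))) * (n:ℝ)⁻¹) * (|Q.eval 0| ^ p * (1/2) ^ p) := by ring
    _ ≤ _ := by gcongr
end

section
/- Let x_1 < x_2 < ⋯ < x_n be real numbers and let 1 ≤ j ≤ n−1. Then there exists a real polynomial π of degree at most n−1 such that π(x_ℓ) = 0 for every ℓ ∈ {1,…,n} with ℓ ∉ {j, j+1}, π(x_j) = π(x_{j+1}) = 1, and π(y) ≥ 1 for every y ∈ [x_j, x_{j+1}]. -/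
open Polynomial in
theorem aux_poly_s15 {ι : Type*} (S : Finset ι) (c d : ι → ℝ) (a b : ℝ) (hab : a < b)
    (ha : ∀ i ∈ S, 0 < c i + d i * a) (hb : ∀ i ∈ S, 0 < c i + d i * b) :
    ∃ p : Polynomial ℝ, p.natDegree ≤ S.card + 1 ∧
      (∀ i ∈ S, ∀ z, c i + d i * z = 0 → p.eval z = 0) ∧
      p.eval a = 1 ∧ p.eval b = 1 ∧ ∀ y ∈ Set.Icc a b, 1 ≤ p.eval y := by
  set A := ∏ i ∈ S, (c i + d i * a) with hA
  set B := ∏ i ∈ S, (c i + d i * b) with hB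
  have hA0 : 0 < A := Finset.prod_pos ha
  have hB0 : 0 < B := Finset.prod_pos hb
  have hba : b - a ≠ 0 := by linarith
  have hev : ∀ y, ((∏ i ∈ S, (C (c i) + C (d i) * X)) *
      (C A⁻¹ + C ((B⁻¹ - A⁻¹) / (b - a)) * (X - C a))).eval y =
      (∏ i ∈ S, (c i + d i * y)) * (A⁻¹ + (B⁻¹ - A⁻¹) / (b - a) * (y - a)) := by
    intro y
    simp [eval_prod]
  refine ⟨(∏ i ∈ S, (C (c i) + C (d i) * X)) *
      (C A⁻¹ + C ((B⁻¹ - A⁻¹) / (b - a)) * (X - C a)), ?_, ?_, ?_, ?_, ?_⟩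
  · refine natDegree_mul_le.trans (add_le_add ?_ ?_)
    · refine (natDegree_prod_le _ _).trans ?_
      rw [Finset.card_eq_sum_ones]
      apply Finset.sum_le_sum
      intro i _
      compute_degree
    · compute_degree
  · intro i hi z hz
    rw [hev, Finset.prod_eq_zero hi hz, zero_mul]
  · rw [hev, ← hA]; simp [hA0.ne']
  · rw [hev, ← hB]; field_simp; ring
  · rintro y ⟨h1, h2⟩
    rw [hev]
    obtain ⟨t, ht⟩ : ∃ t, t = (y - a) / (b - a) := ⟨_, rfl⟩
    have hba' : 0 < b - a := by linarith
    have ht0 : 0 ≤ t := by rw [ht]; apply div_nonneg <;> linarith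
    have ht1 : 0 ≤ 1 - t := by
      rw [ht, sub_nonneg, div_le_one hba']; linarith
    have hy : y = (1 - t) * a + t * b := by rw [ht]; field_simp; ring
    have hL : A⁻¹ + (B⁻¹ - A⁻¹) / (b - a) * (y - a) = (1 - t) * A⁻¹ + t * B⁻¹ := by
      rw [ht]; field_simp; ring
    have k1 : A ^ (1 - t) * B ^ t ≤ ∏ i ∈ S, (c i + d i * y) := by
      rw [hA, hB, ← Real.finsetProd_rpow _ _ (fun i hi => (ha i hi).le),
        ← Real.finsetProd_rpow _ _ (fun i hi => (hb i hi).le), ← Finset.prod_mul_distrib]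
      apply Finset.prod_le_prod
      · intro i hi
        have := ha i hi
        have := hb i hi
        positivity
      · intro i hi
        refine (Real.geom_mean_le_arith_mean2_weighted ht1 ht0 (ha i hi).le (hb i hi).le
          (by ring)).trans (le_of_eq ?_)
        rw [hy]; ring
    have k2 : (A⁻¹) ^ (1 - t) * (B⁻¹) ^ t ≤ (1 - t) * A⁻¹ + t * B⁻¹ :=
      Real.geom_mean_le_arith_mean2_weighted ht1 ht0 (by positivity) (by positivity) (by ring)
    rw [hL]
    have k3 : (A ^ (1 - t) * B ^ t) * ((A⁻¹) ^ (1 - t) * (B⁻¹) ^ t) = 1 := by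
      rw [Real.inv_rpow hA0.le, Real.inv_rpow hB0.le]
      have : 0 < A ^ (1 - t) := by positivity
      have : 0 < B ^ t := by positivity
      field_simp
    refine k3.symm.le.trans ?_
    exact mul_le_mul k1 k2 (by positivity) (le_trans (by positivity) k1)

theorem stmt_15 (n : ℕ) (x : Fin n → ℝ) (hx : StrictMono x)
    (j : ℕ) (hj : j + 1 < n) :
    ∃ π : Polynomial ℝ, π.natDegree ≤ n - 1 ∧
      (∀ ℓ : Fin n, (ℓ : ℕ) ≠ j → (ℓ : ℕ) ≠ j + 1 → π.eval (x ℓ) = 0) ∧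
      π.eval (x ⟨j, by omega⟩) = 1 ∧ π.eval (x ⟨j + 1, hj⟩) = 1 ∧
      ∀ y ∈ Set.Icc (x ⟨j, by omega⟩) (x ⟨j + 1, hj⟩), 1 ≤ π.eval y := by
  have hj' : j < n := by omega
  let S : Finset (Fin n) := Finset.univ \ {⟨j, hj'⟩, ⟨j + 1, hj⟩}
  have hS : ∀ i : Fin n, i ∈ S ↔ (i : ℕ) ≠ j ∧ (i : ℕ) ≠ j + 1 := by
    intro i
    simp [S, Fin.ext_iff]
  have hc : S.card = n - 2 := by
    simp only [S]
    rw [Finset.card_sdiff_of_subset (Finset.subset_univ _), Finset.card_pair (by simp [Fin.ext_iff])]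
    simp
  obtain ⟨p, h1, h2, h3, h4, h5⟩ := aux_poly_s15 S
    (fun i => if (i : ℕ) < j then - x i else x i) (fun i => if (i : ℕ) < j then 1 else -1)
    (x ⟨j, hj'⟩) (x ⟨j + 1, hj⟩) (hx (by simp [Fin.lt_def]))
    (by
      intro i hi
      rw [hS] at hi
      by_cases h : (i : ℕ) < j
      · have : x i < x ⟨j, hj'⟩ := hx (by simpa [Fin.lt_def] using h)
        simp only [h, if_true]; linarith
      · have : x ⟨j, hj'⟩ < x i := hx (by simp only [Fin.lt_def]; omega)
        simp only [h, if_false]; linarith)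
    (by
      intro i hi
      rw [hS] at hi
      by_cases h : (i : ℕ) < j
      · have : x i < x ⟨j + 1, hj⟩ := hx (by simp only [Fin.lt_def]; omega)
        simp only [h, if_true]; linarith
      · have : x ⟨j + 1, hj⟩ < x i := hx (by simp only [Fin.lt_def]; omega)
        simp only [h, if_false]; linarith)
  refine ⟨p, by omega, ?_, h3, h4, h5⟩
  intro l hl hl'
  refine h2 l ((hS l).2 ⟨hl, hl'⟩) _ ?_
  split_ifs <;> ring
end

section
/- Let x_1 < x_2 < ⋯ < x_n be the zeros of the orthonormal polynomial p_n(·;dμ), and let λ_1, …, λ_n > 0 be Gauss–Jacobi quadrature weights, i.e. Σ_{ℓ=1}^n λ_ℓ·π(x_ℓ) = ∫ π dμ for every real polynomial π of degree at most 2n−1. Then for every 1 ≤ j ≤ n−1, μ([x_j, x_{j+1}]) ≤ λ_j + λ_{j+1}. -/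
open scoped BigOperators
open MeasureTheory

/-- The (topological) support of a measure on `ℝ`: the set of points all of whose
neighborhoods have positive measure. -/
def measSupport (μ : Measure ℝ) : Set ℝ := {x : ℝ | ∀ U ∈ nhds x, 0 < μ U}

lemma supp_null (μ : Measure ℝ) : μ (measSupport μ)ᶜ = 0 := by
  apply measure_null_of_locally_null
  intro x hx
  simp only [measSupport, Set.mem_compl_iff, Set.mem_ofPred_eq, not_forall, not_lt,
    nonpos_iff_eq_zero] at hx
  obtain ⟨U, hU, h0⟩ := hx
  exact ⟨U, mem_nhdsWithin_of_mem_nhds hU, h0⟩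

lemma poly_integrable (μ : Measure ℝ) [IsFiniteMeasure μ]
    (hcompact : IsCompact (measSupport μ)) (Q : Polynomial ℝ) :
    Integrable (fun y => Q.eval y) μ := by
  have h : IntegrableOn (fun y => Q.eval y) (measSupport μ) μ :=
    Q.continuous.continuousOn.integrableOn_compact hcompact
  have h2 : μ.restrict (measSupport μ) = μ := by
    apply Measure.restrict_eq_self_of_ae_mem
    exact supp_null μ
  rwa [IntegrableOn, h2] at h

lemma key {ι : Type*} (s : Finset ι) (x : ι → ℝ) (u v a b : ℝ) (ha : 0 ≤ a) (hb : 0 ≤ b)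
    (hab : a + b = 1) (h : ∀ i ∈ s, (x i < u ∧ x i < v) ∨ (u < x i ∧ v < x i)) :
    1 ≤ (a * (∏ i ∈ s, |u - x i|)⁻¹ + b * (∏ i ∈ s, |v - x i|)⁻¹)
      * ∏ i ∈ s, |a * u + b * v - x i| := by
  have hU : 0 < ∏ i ∈ s, |u - x i| := Finset.prod_pos fun i hi => abs_pos.2 (by
    rcases h i hi with h | h
    · exact (sub_pos.2 h.1).ne'
    · exact (sub_neg.2 h.1).ne)
  have hV : 0 < ∏ i ∈ s, |v - x i| := Finset.prod_pos fun i hi => abs_pos.2 (by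
    rcases h i hi with h | h
    · exact (sub_pos.2 h.2).ne'
    · exact (sub_neg.2 h.2).ne)
  have h1 : (∏ i ∈ s, |u - x i|) ^ a * (∏ i ∈ s, |v - x i|) ^ b
      ≤ ∏ i ∈ s, |a * u + b * v - x i| := by
    rw [← Real.finsetProd_rpow _ _ (fun i _ => abs_nonneg _),
      ← Real.finsetProd_rpow _ _ (fun i _ => abs_nonneg _), ← Finset.prod_mul_distrib]
    apply Finset.prod_le_prod
    · intro i _
      positivity
    · intro i hi
      refine (Real.geom_mean_le_arith_mean2_weighted ha hb (abs_nonneg _) (abs_nonneg _)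
        hab).trans (le_of_eq ?_)
      have e : a * u + b * v - x i = a * (u - x i) + b * (v - x i) := by
        linear_combination (-x i) * (1 - hab)
      rcases h i hi with h | h
      · have := sub_pos.2 h.1
        have := sub_pos.2 h.2
        rw [e, abs_of_pos, abs_of_pos, abs_of_nonneg] <;> first | assumption | positivity
      · have h1 := sub_neg.2 h.1
        have h2 := sub_neg.2 h.2
        rw [e, abs_of_neg h1, abs_of_neg h2, abs_of_nonpos]
        · ring
        · nlinarith
  have h2 := Real.geom_mean_le_arith_mean2_weighted ha hb (inv_pos.2 hU).le (inv_pos.2 hV).le hab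
  refine le_trans (le_of_eq ?_) (mul_le_mul h2 h1 (by positivity) (by positivity))
  rw [Real.inv_rpow hU.le, Real.inv_rpow hV.le]
  have := Real.rpow_pos_of_pos hU a
  have := Real.rpow_pos_of_pos hV b
  field_simp

theorem stmt_16 (μ : Measure ℝ) [IsFiniteMeasure μ]
    (hcompact : IsCompact (measSupport μ)) (hinf : (measSupport μ).Infinite)
    (p : ℕ → Polynomial ℝ)
    (hdeg : ∀ k, (p k).natDegree = k)
    (hlead : ∀ k, 0 < (p k).leadingCoeff)
    (horth : ∀ k m, ∫ x, (p k).eval x * (p m).eval x ∂μ = if k = m then 1 else 0)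
    (n : ℕ) (hn : 1 ≤ n)
    (x : Fin n → ℝ) (hx : StrictMono x)
    (hzeros : ∀ y : ℝ, (p n).eval y = 0 ↔ ∃ i : Fin n, y = x i)
    (lam : Fin n → ℝ) (hlampos : ∀ i, 0 < lam i)
    (hquad : ∀ Q : Polynomial ℝ, Q.natDegree ≤ 2 * n - 1 →
      ∑ i : Fin n, lam i * Q.eval (x i) = ∫ y, Q.eval y ∂μ) :
    ∀ (j : ℕ) (hj : j + 1 < n),
      (μ (Set.Icc (x ⟨j, by omega⟩) (x ⟨j + 1, hj⟩))).toReal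
        ≤ lam ⟨j, by omega⟩ + lam ⟨j + 1, hj⟩ := by
  intro j hj
  set J : Fin n := ⟨j, by omega⟩ with hJ
  set K : Fin n := ⟨j + 1, hj⟩ with hK
  have hJK : J < K := by simp [hJ, hK]
  have huv : x J < x K := hx hJK
  set s : Finset (Fin n) := (Finset.univ.erase J).erase K with hs
  have hcard : s.card = n - 2 := by
    rw [hs, Finset.card_erase_of_mem (by simp [hJK.ne']), Finset.card_erase_of_mem (by simp)]
    simp; omega
  have hsep : ∀ i ∈ s, (x i < x J ∧ x i < x K) ∨ (x J < x i ∧ x K < x i) := by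
    intro i hi
    simp only [hs, Finset.mem_erase, Finset.mem_univ, and_true] at hi
    rcases lt_trichotomy i J with h | h | h
    · exact Or.inl ⟨hx h, hx (h.trans hJK)⟩
    · exact absurd h hi.2
    · have : K < i := by
        have h1 : (i : ℕ) ≠ j + 1 := fun e => hi.1 (Fin.ext e)
        have h2 : j < (i : ℕ) := h
        show j + 1 < (i : ℕ)
        omega
      exact Or.inr ⟨hx h, hx this⟩
  set U := ∏ i ∈ s, |x J - x i| with hUdef
  set V := ∏ i ∈ s, |x K - x i| with hVdef
  have hU : U ≠ 0 := Finset.prod_ne_zero_iff.2 fun i hi => abs_ne_zero.2 (by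
    rcases hsep i hi with h | h
    · exact (sub_pos.2 h.1).ne'
    · exact (sub_neg.2 h.1).ne)
  have hV : V ≠ 0 := Finset.prod_ne_zero_iff.2 fun i hi => abs_ne_zero.2 (by
    rcases hsep i hi with h | h
    · exact (sub_pos.2 h.2).ne'
    · exact (sub_neg.2 h.2).ne)
  have hd : x K - x J ≠ 0 := (sub_pos.2 huv).ne'
  let ℓ : Polynomial ℝ := Polynomial.C (U⁻¹ / (x K - x J)) * (Polynomial.C (x K) - Polynomial.X)
    + Polynomial.C (V⁻¹ / (x K - x J)) * (Polynomial.X - Polynomial.C (x J))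
  let W : Polynomial ℝ := ∏ i ∈ s, (Polynomial.X - Polynomial.C (x i))
  let Q : Polynomial ℝ := (ℓ * W) ^ 2
  have hW : W.natDegree ≤ n - 2 := by
    rw [← hcard]
    refine (Polynomial.natDegree_prod_le _ _).trans ?_
    simp
  have hℓ : ℓ.natDegree ≤ 1 := by
    show Polynomial.natDegree (_ + _) ≤ 1
    compute_degree
  have hQdeg : Q.natDegree ≤ 2 * n - 1 := by
    have h1 := Polynomial.natDegree_pow_le (p := ℓ * W) (n := 2)
    have h2 := Polynomial.natDegree_mul_le (p := ℓ) (q := W)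
    show ((ℓ * W) ^ 2).natDegree ≤ _
    omega
  have hQ : ∀ y, Q.eval y = ((U⁻¹ / (x K - x J) * (x K - y) + V⁻¹ / (x K - x J) * (y - x J))
      * ∏ i ∈ s, |y - x i|) ^ 2 := by
    intro y
    have hWe : (∏ i ∈ s, |y - x i|) = |W.eval y| := by
      simp [W, Polynomial.eval_prod, Finset.abs_prod]
    rw [hWe, mul_pow, sq_abs]
    simp [Q, ℓ, mul_pow]
  have hQJ : Q.eval (x J) = 1 := by
    rw [hQ, ← hUdef]
    field_simp
    ring
  have hQK : Q.eval (x K) = 1 := by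
    rw [hQ, ← hVdef]
    field_simp
    ring
  have hQs : ∀ i ∈ s, Q.eval (x i) = 0 := by
    intro i hi
    rw [hQ, Finset.prod_eq_zero hi (by simp)]
    simp
  have hsum : ∑ i : Fin n, lam i * Q.eval (x i) = lam J + lam K := by
    rw [← Finset.add_sum_erase _ _ (Finset.mem_univ J),
      ← Finset.add_sum_erase _ _ (show K ∈ Finset.univ.erase J by simp [hJK.ne']),
      Finset.sum_eq_zero (fun i hi => by rw [hQs i hi, mul_zero]), hQJ, hQK]
    ring
  rw [← hsum, hquad Q hQdeg]
  have hge : ∀ y ∈ Set.Icc (x J) (x K), 1 ≤ Q.eval y := by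
    intro y hy
    have hd' := sub_pos.2 huv
    have h := key s x (x J) (x K) ((x K - y) / (x K - x J)) ((y - x J) / (x K - x J))
      (div_nonneg (sub_nonneg.2 hy.2) hd'.le) (div_nonneg (sub_nonneg.2 hy.1) hd'.le)
      (by field_simp; ring) hsep
    have e : (x K - y) / (x K - x J) * x J + (y - x J) / (x K - x J) * x K = y := by
      field_simp; ring
    rw [e, ← hUdef, ← hVdef] at h
    rw [hQ]
    apply one_le_pow₀
    refine h.trans (le_of_eq ?_)
    ring
  have hint := poly_integrable μ hcompact Q
  calc (μ (Set.Icc (x J) (x K))).toReal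
      = ∫ y, (Set.Icc (x J) (x K)).indicator (fun _ => (1 : ℝ)) y ∂μ := by
        rw [integral_indicator measurableSet_Icc]
        simp [Measure.real]
    _ ≤ ∫ y, Q.eval y ∂μ := by
        apply integral_mono _ hint
        · intro y
          by_cases hy : y ∈ Set.Icc (x J) (x K)
          · simpa [Set.indicator_of_mem hy] using hge y hy
          · simp only [Set.indicator_of_notMem hy, hQ]
            positivity
        · exact (integrable_const 1).indicator measurableSet_Icc
end

section
/- Let μ be a probability measure with compact infinite support, E_− = inf supp μ, E_+ = sup supp μ, and d(E) = max(E_+ − E, E − E_−). Let I be a closed interval on which μ is purely absolutely continuous with density w satisfying 0 < inf_{x∈I} w(x) ≤ sup_{x∈I} w(x) < ∞. Let E be in the interior of I, and assume that for all sufficiently large n both z_n^{(1)}(E) and z_n^{(−1)}(E) exist. Then limsup_{n→∞} n·[z_n^{(1)}(E) − z_n^{(−1)}(E)] ≤ 4π·d(E)·lim_{δ↓0} ( sup{w(x) : |x−E|<δ} / inf{w(x) : |x−E|<δ} ). In particular, if w is continuous at E, then limsup_{n→∞} n·[z_n^{(1)}(E) − z_n^{(−1)}(E)] ≤ 4π·d(E),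 independently of the value of w(E). -/
open scoped BigOperators
open MeasureTheory Filter

lemma ae_support (μ : Measure ℝ) : ∀ᵐ x ∂μ, x ∈ measSupport μ := by
  rw [ae_iff]
  apply measure_null_of_locally_null
  intro x hx
  simp only [measSupport, Set.mem_ofPred_eq, not_forall, not_lt, nonpos_iff_eq_zero] at hx
  obtain ⟨U, hU, h0⟩ := hx
  exact ⟨U, mem_nhdsWithin_of_mem_nhds hU, h0⟩

lemma poly_int (μ : Measure ℝ) [IsProbabilityMeasure μ] (hc : IsCompact (measSupport μ))
    (q : Polynomial ℝ) : Integrable (fun x => q.eval x) μ := by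
  obtain ⟨C, hC⟩ := hc.exists_bound_of_continuousOn (f := fun x => q.eval x) q.continuous.continuousOn
  refine Integrable.of_bound (C := C) q.continuous.aestronglyMeasurable ?_
  filter_upwards [ae_support μ] with x hx using hC x hx

section
open Polynomial

lemma orth_lt (μ : Measure ℝ) [IsProbabilityMeasure μ] (hc : IsCompact (measSupport μ))
    (p : ℕ → Polynomial ℝ)
    (hdeg : ∀ k, (p k).natDegree = k)
    (hlead : ∀ k, 0 < (p k).leadingCoeff)
    (horth : ∀ k m, ∫ x, (p k).eval x * (p m).eval x ∂μ = if k = m then 1 else 0)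
    (n : ℕ) : ∀ k ≤ n, ∀ s : ℝ[X], s.degree < k → ∫ x, (p n * s).eval x ∂μ = 0 := by
  intro k
  induction k with
  | zero =>
    intro _ s hs
    have : s = 0 := by simpa using hs
    simp [this]
  | succ k ih =>
    intro hk s hs
    set a := s.coeff k / (p k).leadingCoeff with ha
    have hlc : (p k).coeff k = (p k).leadingCoeff := by rw [leadingCoeff, hdeg]
    have h1 : (s - C a * p k).degree < k := by
      rw [degree_lt_iff_coeff_zero] at hs ⊢
      intro m hm
      rcases hm.eq_or_lt with rfl | hm
      · simp only [coeff_sub, coeff_C_mul, hlc, ha]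
        rw [div_mul_cancel₀ _ (hlead _).ne', sub_self]
      · rw [coeff_sub, coeff_C_mul, hs m hm, coeff_eq_zero_of_natDegree_lt (by rw [hdeg]; exact hm)]
        simp
    have h2 := ih (by omega) _ h1
    have h3 : p n * s = p n * (s - C a * p k) + C a * (p n * p k) := by ring
    rw [h3]
    simp only [eval_add]
    rw [integral_add (poly_int μ hc _) (poly_int μ hc _), h2]
    simp only [eval_mul, eval_C]
    rw [integral_const_mul, horth, if_neg (by omega)]
    simp

lemma no_quad (μ : Measure ℝ) [IsProbabilityMeasure μ] (hc : IsCompact (measSupport μ))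
    (p : ℕ → Polynomial ℝ)
    (hdeg : ∀ k, (p k).natDegree = k)
    (hlead : ∀ k, 0 < (p k).leadingCoeff)
    (horth : ∀ k m, ∫ x, (p k).eval x * (p m).eval x ∂μ = if k = m then 1 else 0)
    (n : ℕ) (g : ℝ[X]) (hg : ∀ x, 0 ≤ g.eval x) (hgd : 0 < g.natDegree) (hd : g ∣ p n) : False := by
  obtain ⟨h, hh⟩ := hd
  have hp0 : p n ≠ 0 := by
    intro h0; have := hlead n; simp [h0] at this
  have hg0 : g ≠ 0 := by rintro rfl; simp at hgd
  have hh0 : h ≠ 0 := by rintro rfl; simp at hh; exact hp0 hh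
  have hdd : h.degree < n := by
    have := congrArg natDegree hh
    rw [natDegree_mul hg0 hh0, hdeg] at this
    rw [degree_eq_natDegree hh0]; exact_mod_cast (by omega)
  have h1 := orth_lt μ hc p hdeg hlead horth n n le_rfl h hdd
  have h2 : ∀ x, (p n * h).eval x = g.eval x * (h.eval x)^2 := by
    intro x; rw [hh]; simp; ring
  have h3 : (fun x => (p n * h).eval x) =ᵐ[μ] 0 := by
    rw [← integral_eq_zero_iff_of_nonneg _ (poly_int μ hc _)]
    · exact h1
    · intro x; simp only [Pi.zero_apply]; rw [h2]; exact mul_nonneg (hg x) (sq_nonneg _)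
  have h4 : ∫ x, (p n).eval x * (p n).eval x ∂μ = 0 := by
    apply integral_eq_zero_of_ae
    filter_upwards [h3] with x hx
    simp only [Pi.zero_apply] at hx ⊢
    rw [eval_mul] at hx
    rcases mul_eq_zero.1 hx with h | h
    · simp [h]
    · simp [hh, h]
  rw [horth] at h4; simp at h4

lemma roots_facts (μ : Measure ℝ) [IsProbabilityMeasure μ] (hc : IsCompact (measSupport μ))
    (p : ℕ → Polynomial ℝ)
    (hdeg : ∀ k, (p k).natDegree = k)
    (hlead : ∀ k, 0 < (p k).leadingCoeff)
    (horth : ∀ k m, ∫ x, (p k).eval x * (p m).eval x ∂μ = if k = m then 1 else 0)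
    (n : ℕ) : (p n).roots.Nodup ∧ Multiset.card (p n).roots = n := by
  have hp0 : p n ≠ 0 := by
    intro h0; have := hlead n; simp [h0] at this
  constructor
  · rw [Multiset.nodup_iff_count_le_one]
    intro a
    by_contra! hcon
    rw [count_roots] at hcon
    have hd : (X - C a)^2 ∣ p n := (pow_dvd_pow _ hcon).trans (pow_rootMultiplicity_dvd _ _)
    refine no_quad μ hc p hdeg hlead horth n _ (fun x => ?_) ?_ hd
    · simp; positivity
    · simp
  · obtain ⟨q, hq, hcard, hr⟩ := exists_prod_multiset_X_sub_C_mul (p n)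
    rw [hdeg] at hcard
    by_contra hne
    have hqd : 0 < q.natDegree := by omega
    have hq0 : q ≠ 0 := by rintro rfl; simp at hqd
    obtain ⟨z, hz⟩ := IsAlgClosed.exists_aeval_eq_zero ℂ q (by
      rw [degree_eq_natDegree hq0]; exact_mod_cast hqd.ne')
    have hzim : z.im ≠ 0 := by
      intro h0
      have hz' : z = ((z.re : ℝ) : ℂ) := by
        apply Complex.ext <;> simp [h0]
      have : q.eval z.re = 0 := by
        rw [hz'] at hz
        have h := Polynomial.aeval_algebraMap_apply_eq_algebraMap_eval (A := ℂ) z.re q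
        simp only [Complex.coe_algebraMap] at h
        rw [h] at hz
        exact_mod_cast hz
      have hm : z.re ∈ q.roots := by rw [mem_roots hq0]; exact this
      rw [hr] at hm; simp at hm
    have hd := quadratic_dvd_of_aeval_eq_zero_im_ne_zero q hz hzim
    refine no_quad μ hc p hdeg hlead horth n _ (fun x => ?_) ?_ (hd.trans ⟨_, by rw [mul_comm]; exact hq.symm⟩)
    · have : ‖z‖^2 = z.re^2+z.im^2 := by
        rw [← Complex.normSq_eq_norm_sq, Complex.normSq_apply]; ring
      simp only [eval_add, eval_sub, eval_pow, eval_X, eval_mul, eval_C, this]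
      nlinarith [sq_nonneg (x - z.re), sq_nonneg z.im]
    · have : (X ^ 2 - C (2 * z.re) * X + C (‖z‖ ^ 2) : ℝ[X]).natDegree = 2 := by compute_degree!
      omega

lemma quad_nonpos (μ : Measure ℝ) [IsProbabilityMeasure μ] (hc : IsCompact (measSupport μ))
    (p : ℕ → Polynomial ℝ)
    (hdeg : ∀ k, (p k).natDegree = k)
    (hlead : ∀ k, 0 < (p k).leadingCoeff)
    (horth : ∀ k m, ∫ x, (p k).eval x * (p m).eval x ∂μ = if k = m then 1 else 0)
    (n : ℕ) (hn : 0 < n) (f : ℝ[X]) (hf : f.natDegree < 2 * n)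
    (hroot : ∀ x, (p n).eval x = 0 → f.eval x ≤ 0) : ∫ x, f.eval x ∂μ ≤ 0 := by
  obtain ⟨hnd, hcard⟩ := roots_facts μ hc p hdeg hlead horth n
  have hp0 : p n ≠ 0 := by
    intro h0; have := hlead n; simp [h0] at this
  set S := (p n).roots.toFinset with hS
  have hSc : S.card = n := by rw [hS, Multiset.toFinset_card_of_nodup hnd, hcard]
  have hinj : Set.InjOn (id : ℝ → ℝ) S := Set.injOn_id _
  set l : ℝ → ℝ[X] := fun a => Lagrange.basis S id a with hl
  set F := f - ∑ a ∈ S, C (f.eval a) * (l a)^2 with hF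
  have hld : ∀ a ∈ S, (l a).natDegree = n - 1 := by
    intro a ha; rw [hl]; simp only; rw [Lagrange.natDegree_basis hinj ha, hSc]
  have hFd : F.natDegree < 2 * n := by
    have h1 : (∑ a ∈ S, C (f.eval a) * (l a)^2).natDegree ≤ 2 * (n-1) := by
      apply natDegree_sum_le_of_forall_le
      intro a ha
      refine (natDegree_C_mul_le _ _).trans (natDegree_pow_le.trans ?_)
      rw [hld a ha]
    have h2 := natDegree_sub_le f (∑ a ∈ S, C (f.eval a) * (l a)^2)
    rw [← hF] at h2
    omega
  have hFz : ∀ b ∈ S, F.eval b = 0 := by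
    intro b hb
    rw [hF, eval_sub, eval_finsetSum, Finset.sum_eq_single b]
    · have := Lagrange.eval_basis_self hinj hb
      simp only [id] at this
      simp [hl, this]
    · intro a ha hab
      have := Lagrange.eval_basis_of_ne (v := (id : ℝ → ℝ)) hab hb
      simp only [id] at this
      simp [hl, this]
    · exact fun h => absurd hb h
  have hdvd : p n ∣ F := by
    have hsp : p n = C (p n).leadingCoeff * ((p n).roots.map fun a => X - C a).prod :=
      (C_leadingCoeff_mul_prod_multiset_X_sub_C (by rw [hcard, hdeg])).symm
    rw [hsp]
    have hu : IsUnit (C (p n).leadingCoeff) := isUnit_C.2 (hlead n).ne'.isUnit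
    rw [hu.mul_left_dvd]
    by_cases hF0 : F = 0
    · rw [hF0]; exact dvd_zero _
    rw [Multiset.prod_X_sub_C_dvd_iff_le_roots hF0, Multiset.le_iff_subset hnd]
    intro a ha
    rw [mem_roots hF0]
    exact hFz a (by rw [hS]; exact Multiset.mem_toFinset.2 ha)
  obtain ⟨s, hs⟩ := hdvd
  have hsint : ∫ x, F.eval x ∂μ = 0 := by
    rw [hs]
    apply orth_lt μ hc p hdeg hlead horth n n le_rfl
    by_cases hs0 : s = 0
    · rw [hs0, degree_zero]; exact WithBot.bot_lt_coe _
    rw [degree_eq_natDegree hs0]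
    have : F.natDegree = n + s.natDegree := by rw [hs, natDegree_mul hp0 hs0, hdeg]
    exact_mod_cast (by omega)
  have hfe : f = F + ∑ a ∈ S, C (f.eval a) * (l a)^2 := by rw [hF]; ring
  have : ∀ x, f.eval x = F.eval x + (∑ a ∈ S, C (f.eval a) * (l a)^2).eval x := by
    intro x; conv_lhs => rw [hfe]
    simp
  rw [integral_congr_ae (Filter.Eventually.of_forall this)]
  rw [integral_add (poly_int μ hc _) (poly_int μ hc _), hsint, zero_add]
  apply integral_nonpos
  intro x
  simp only [eval_finsetSum, Pi.zero_apply]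
  apply Finset.sum_nonpos
  intro a ha
  have : (p n).eval a = 0 := by
    have : a ∈ (p n).roots := by simpa [hS] using ha
    exact (mem_roots hp0).1 this
  simp only [eval_mul, eval_C, eval_pow]
  exact mul_nonpos_of_nonpos_of_nonneg (hroot a this) (sq_nonneg _)

lemma abs_sin_nat (n : ℕ) (t : ℝ) : |Real.sin (n * t)| ≤ n * |Real.sin t| := by
  induction n with
  | zero => simp
  | succ n ih =>
    push_cast
    rw [add_mul, one_mul, Real.sin_add]
    calc _ ≤ |Real.sin (n*t) * Real.cos t| + |Real.cos (n*t) * Real.sin t| := abs_add_le _ _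
      _ ≤ |Real.sin (n*t)| * 1 + 1 * |Real.sin t| := by
        rw [abs_mul, abs_mul]; gcongr
        · exact Real.abs_cos_le_one _
        · exact Real.abs_cos_le_one _
      _ ≤ _ := by linarith

lemma cheb_exists (j : ℕ) (N : ℝ) (hN : N = 2 * j + 1) : ∃ V : ℝ[X], V.natDegree ≤ 2 * j ∧
    ∀ y : ℝ, |y| ≤ 1 → |y * V.eval y| ≤ 1 ∧ |y * V.eval y| ≤ N * |y| ∧
      (|y| ≤ 2 / (3 * N) → 25 / 27 * N * |y| ≤ |y * V.eval y|) := by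
  set k : ℤ := 2 * j + 1 with hk
  have hkN : (k : ℝ) = N := by rw [hk, hN]; push_cast; ring
  have hN1 : 1 ≤ N := by rw [hN]; have : (0:ℝ) ≤ j := Nat.cast_nonneg j
                         linarith
  have hT0 : (Chebyshev.T ℝ k).eval 0 = 0 := Chebyshev.T_eval_zero_of_odd ℝ ⟨j, rfl⟩
  obtain ⟨V, hV⟩ : X ∣ Chebyshev.T ℝ k := by
    rw [X_dvd_iff, coeff_zero_eq_eval_zero, hT0]
  have hVe : ∀ y, y * V.eval y = (Chebyshev.T ℝ k).eval y := by intro y; rw [hV]; simp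
  have hcos : Real.cos (k * (Real.pi/2)) = 0 := by
    rw [← Chebyshev.T_real_cos, Real.cos_pi_div_two, hT0]
  have hsin : |Real.sin (k * (Real.pi/2))| = 1 := by
    have := Real.sin_sq_add_cos_sq (k * (Real.pi/2))
    rw [hcos] at this
    rw [← sq_eq_sq₀ (abs_nonneg _) zero_le_one, sq_abs]; linarith
  have key : ∀ y, |y| ≤ 1 → |y * V.eval y| = |Real.sin (N * Real.arcsin y)| := by
    intro y hy
    rw [abs_le] at hy
    have hy2 : y = Real.cos (Real.pi/2 - Real.arcsin y) := by
      rw [Real.cos_pi_div_two_sub, Real.sin_arcsin hy.1 hy.2]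
    rw [hVe]
    conv_lhs => rw [hy2]
    rw [Chebyshev.T_real_cos, mul_sub, Real.cos_sub, hcos, zero_mul, zero_add, abs_mul, hsin, one_mul,
      hkN]
  refine ⟨V, ?_, ?_⟩
  · have h := congrArg natDegree hV
    have hV0 : V ≠ 0 := by
      rintro rfl; simp only [mul_zero] at hV; exact Chebyshev.T_ne_zero ℝ k hV
    rw [Chebyshev.natDegree_T, natDegree_mul X_ne_zero hV0, natDegree_X] at h
    omega
  · intro y hy
    rw [key y hy]
    refine ⟨Real.abs_sin_le_one _, ?_, ?_⟩
    · have h := abs_sin_nat (2*j+1) (Real.arcsin y)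
      rw [Real.sin_arcsin (abs_le.1 hy).1 (abs_le.1 hy).2] at h
      push_cast at h
      rw [hN]; exact h
    · intro hy2
      have : ∀ u : ℝ, 0 ≤ u → u ≤ 1 → u ≤ 2/(3*N) → 25/27*N*u ≤ |Real.sin (N * Real.arcsin u)| := by
        intro u hu0 hu1 hu
        have hNu : N * u ≤ 2/3 := by
          rw [le_div_iff₀ (by positivity)] at hu; linarith
        have hpi := Real.pi_gt_three
        have ha0 : 0 ≤ Real.arcsin u := Real.arcsin_nonneg.2 hu0
        have hs := Real.sin_arcsin (by linarith) hu1
        have hau : u ≤ Real.arcsin u := by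
          conv_lhs => rw [← hs]
          exact Real.sin_le ha0
        have hua : Real.arcsin u ≤ Real.pi/2 * u := by
          have := Real.mul_le_sin ha0 (Real.arcsin_le_pi_div_two u)
          rw [hs] at this
          have hp : 0 < Real.pi := Real.pi_pos
          calc Real.arcsin u = Real.pi/2 * (2/Real.pi * Real.arcsin u) := by field_simp
            _ ≤ _ := by gcongr
        have hNa : N * Real.arcsin u ≤ Real.pi/2 := by
          calc N * Real.arcsin u ≤ N * (Real.pi/2 * u) := by gcongr
            _ = Real.pi/2 * (N*u) := by ring
            _ ≤ Real.pi/2 * 1 := by gcongr; linarith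
            _ = _ := by ring
        have h1 : Real.sin (N*u) ≤ Real.sin (N * Real.arcsin u) := by
          apply Real.sin_le_sin_of_le_of_le_pi_div_two _ hNa (by gcongr)
          have : 0 ≤ N * u := by positivity
          linarith
        refine le_trans ?_ (h1.trans (le_abs_self _))
        rcases hu0.eq_or_lt with rfl | hu0
        · simp
        have h2 := Real.sin_gt_sub_cube (x := N*u) (by positivity)
        have h3 : (N*u)^2 ≤ (2/3)^2 := by gcongr
        have h4 : 0 ≤ N*u := by positivity
        nlinarith [mul_le_mul_of_nonneg_left h3 h4]
      rcases le_total 0 y with h | h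
      · rw [abs_of_nonneg h] at hy hy2 ⊢; exact this y h hy hy2
      · rw [abs_of_nonpos h] at hy hy2 ⊢
        have := this (-y) (by linarith) hy hy2
        rw [Real.arcsin_neg, mul_neg N, Real.sin_neg, abs_neg] at this
        exact this
end

section
open Polynomial

lemma gap_ineq (μ : Measure ℝ) [IsProbabilityMeasure μ] (hc : IsCompact (measSupport μ))
    (p : ℕ → Polynomial ℝ)
    (hdeg : ∀ k, (p k).natDegree = k)
    (hlead : ∀ k, 0 < (p k).leadingCoeff)
    (horth : ∀ k m, ∫ x, (p k).eval x * (p m).eval x ∂μ = if k = m then 1 else 0)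
    (n j : ℕ) (hj : 4 * j + 1 < n) (N : ℝ) (hN : N = 2 * j + 1)
    (x0 h D r m M : ℝ) (hD : 0 < D) (hr : 0 < r) (hm : 0 < m) (hM : 0 < M) (hh : 0 ≤ h)
    (hsupp : ∀ x ∈ measSupport μ, |x - x0| ≤ D)
    (hup : ∀ S ⊆ Set.Ioo (x0 - r) (x0 + r), MeasurableSet S → μ S ≤ ENNReal.ofReal M * volume S)
    (hlo : ∀ S ⊆ Set.Ioo (x0 - r) (x0 + r), MeasurableSet S → ENNReal.ofReal m * volume S ≤ μ S)
    (hroot : ∀ x, (p n).eval x = 0 → h ≤ |x - x0|)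
    (hs : 2 * D / (3 * N) < r) :
    h ^ 2 * ((25/27)^4 * (m * (4 * D / (3 * N)))) ≤
      M * (2 * Real.pi * D^3 / N^3) + D^4 / (N^4 * r^2) := by
  obtain ⟨V, hVd, hV⟩ := cheb_exists j N hN
  have hN1 : 1 ≤ N := by rw [hN]; have : (0:ℝ) ≤ j := Nat.cast_nonneg j
                         linarith
  have hN0 : 0 < N := by linarith
  set Y : ℝ[X] := C (1/D) * (X - C x0) with hY
  set G : ℝ[X] := (C (1/N) * V.comp Y)^2 with hG
  have hYe : ∀ x, Y.eval x = (x - x0)/D := by intro x; simp [hY]; ring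
  have hGe : ∀ x, G.eval x = (V.eval ((x-x0)/D) / N)^2 := by
    intro x; simp only [hG, eval_pow, eval_mul, eval_C, eval_comp, hYe]; ring
  have hYd : Y.natDegree ≤ 1 := by
    refine (natDegree_C_mul_le _ _).trans ?_
    simp
  have hGd : G.natDegree ≤ 4 * j := by
    refine natDegree_pow_le.trans ?_
    have h1 := (natDegree_C_mul_le (1/N) (V.comp Y)).trans natDegree_comp_le
    have h2 : V.natDegree * Y.natDegree ≤ 2 * j * 1 := Nat.mul_le_mul hVd hYd
    omega
  -- pointwise facts
  have hpt : ∀ x, |x - x0| ≤ D → ∃ t : ℝ, 0 ≤ t ∧ t = N * |x - x0| / D ∧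
      t * Real.sqrt (G.eval x) ≤ 1 ∧ t * Real.sqrt (G.eval x) ≤ t ∧
      (t ≤ 2/3 → 25/27 * t ≤ t * Real.sqrt (G.eval x)) := by
    intro x hx
    have hyD : |(x-x0)/D| = |x-x0|/D := by rw [abs_div, abs_of_pos hD]
    have hy1 : |(x-x0)/D| ≤ 1 := by rw [hyD, div_le_one hD]; exact hx
    obtain ⟨h1, h2, h3⟩ := hV _ hy1
    have hsq : Real.sqrt (G.eval x) = |V.eval ((x-x0)/D)| / N := by
      rw [hGe, Real.sqrt_sq_eq_abs, abs_div, abs_of_pos hN0]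
    have ht : N * |x - x0| / D * Real.sqrt (G.eval x) = |(x-x0)/D * V.eval ((x-x0)/D)| := by
      rw [hsq, abs_mul, hyD]; field_simp
    refine ⟨N * |x - x0| / D, by positivity, rfl, ?_, ?_, ?_⟩
    · rw [ht]; exact h1
    · rw [ht]; refine h2.trans_eq ?_
      rw [hyD]; ring
    · intro hle
      rw [ht]
      refine le_trans (le_of_eq ?_) (h3 ?_)
      · rw [hyD]; ring
      · rw [hyD, le_div_iff₀ (by positivity)]
        have : N * |x-x0|/D * 3 = |x - x0|/D * (3 * N) := by ring
        linarith
  have hGnn : ∀ x, 0 ≤ G.eval x := by intro x; rw [hGe]; positivity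
  set B := Set.Ioo (x0 - r) (x0 + r) with hB
  set Φ : ℝ → ℝ := fun x => 2 * D^2 / N^2 * (1 + ((x - x0) * (N / D))^2)⁻¹ with hΦ
  set K := D^4 / (N^4 * r^2) with hK
  have hK0 : 0 ≤ K := by positivity
  have hΦ0 : ∀ x, 0 ≤ Φ x := by intro x; simp only [hΦ]; positivity
  have hupper : ∀ x, |x - x0| ≤ D → (x-x0)^2 * (G.eval x)^2 ≤ B.indicator Φ x + K := by
    intro x hx
    obtain ⟨t, ht0, ht, h1, h2, -⟩ := hpt x hx
    set σ := Real.sqrt (G.eval x) with hσ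
    have hσ0 : 0 ≤ σ := Real.sqrt_nonneg _
    have hGs : G.eval x = σ^2 := (Real.sq_sqrt (hGnn x)).symm
    have hxt : |x - x0| = D / N * t := by rw [ht]; field_simp
    have hxt2 : (x - x0)^2 = D^2 / N^2 * t^2 := by rw [← sq_abs, hxt]; ring
    have hE : (x-x0)^2 * (G.eval x)^2 = D^2/N^2 * (t^2 * σ^4) := by rw [hxt2, hGs]; ring
    rw [hE]
    have hA : t^2 * (t^2 * σ^4) ≤ 1 := by
      have : t^2 * (t^2 * σ^4) = (t*σ)^4 := by ring
      rw [this]; exact pow_le_one₀ (by positivity) h1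
    by_cases hxB : x ∈ B
    · rw [Set.indicator_of_mem hxB]
      have hΦx : Φ x = D^2/N^2 * (2 / (1 + t^2)) := by
        simp only [hΦ]
        have : ((x - x0) * (N / D))^2 = t^2 := by
          rw [mul_pow, hxt2]; field_simp
        rw [this]; ring
      rw [hΦx]
      have : t^2 * σ^4 ≤ 2 / (1 + t^2) := by
        rw [le_div_iff₀ (by positivity)]
        have hB2 : t^2 * σ^4 ≤ 1 := by
          have e : t^2 * σ^4 = (t*σ)^2 * σ^2 := by ring
          rcases ht0.eq_or_lt with h0 | h0
          · rw [← h0]; norm_num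
          have hσ1 : σ ≤ 1 := by
            by_contra! hcon
            nlinarith
          rw [e]
          exact mul_le_one₀ (pow_le_one₀ (by positivity) h1) (by positivity) (pow_le_one₀ hσ0 hσ1)
        linarith
      have := mul_le_mul_of_nonneg_left this (by positivity : 0 ≤ D^2/N^2)
      linarith
    · rw [Set.indicator_of_notMem hxB, zero_add]
      have hrx : r ≤ |x - x0| := by
        by_contra! hcon
        rw [abs_lt] at hcon
        exact hxB ⟨by linarith, by linarith⟩
      have hr2 : r^2 ≤ D^2/N^2 * t^2 := by
        rw [← hxt2, ← sq_abs (x - x0)]; gcongr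
      rw [hK, le_div_iff₀ (by positivity)]
      have e : D^2/N^2 * (t^2*σ^4) * (N^4 * r^2) = D^2 * N^2 * (t^2*σ^4) * r^2 := by
        field_simp
      rw [e]
      calc D^2 * N^2 * (t^2*σ^4) * r^2 ≤ D^2 * N^2 * (t^2*σ^4) * (D^2/N^2 * t^2) := by gcongr
        _ = D^4 * (t^2 * (t^2*σ^4)) := by field_simp
        _ ≤ D^4 * 1 := by gcongr
        _ = _ := by ring
  -- measure comparison
  have hle : μ.restrict B ≤ ENNReal.ofReal M • volume := by
    rw [Measure.le_iff]
    intro s hs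
    rw [Measure.restrict_apply hs, Measure.smul_apply, smul_eq_mul]
    refine (hup _ Set.inter_subset_right (hs.inter measurableSet_Ioo)).trans ?_
    gcongr
    exact Set.inter_subset_left
  have hND : N / D ≠ 0 := by positivity
  have hΦint : Integrable Φ volume := by
    apply Integrable.const_mul
    have h1 := (integrable_inv_one_add_sq.comp_mul_right' hND).comp_sub_right x0
    exact h1
  have hΦval : ∫ x, Φ x = 2 * Real.pi * D^3 / N^3 := by
    simp only [hΦ]
    rw [integral_const_mul]
    rw [integral_sub_right_eq_self (fun x : ℝ => (1 + (x * (N/D))^2)⁻¹) x0]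
    rw [Measure.integral_comp_mul_right (fun x : ℝ => (1 + x^2)⁻¹) (N/D), integral_univ_inv_one_add_sq,
      abs_of_pos (by positivity), smul_eq_mul]
    field_simp
  have hΦint' : Integrable Φ (ENNReal.ofReal M • volume) := hΦint.smul_measure ENNReal.ofReal_ne_top
  have hΦB : ∫ x in B, Φ x ∂μ ≤ M * (2 * Real.pi * D^3 / N^3) := by
    calc ∫ x in B, Φ x ∂μ ≤ ∫ x, Φ x ∂(ENNReal.ofReal M • volume) :=
          integral_mono_measure hle (Filter.Eventually.of_forall hΦ0) hΦint'
      _ = _ := by rw [integral_smul_measure, hΦval, ENNReal.toReal_ofReal hM.le, smul_eq_mul]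
  have hindint : Integrable (B.indicator Φ) μ := by
    rw [integrable_indicator_iff measurableSet_Ioo]
    exact hΦint'.mono_measure hle
  have hU : ∫ x, (x-x0)^2 * (G.eval x)^2 ∂μ ≤ M * (2 * Real.pi * D^3 / N^3) + K := by
    calc _ ≤ ∫ x, (B.indicator Φ x + K) ∂μ := by
          apply integral_mono_ae
          · have := poly_int μ hc ((X - C x0)^2 * G^2)
            simpa using this
          · exact hindint.add (integrable_const _)
          · filter_upwards [ae_support μ] with x hx using hupper x (hsupp x hx)
      _ = ∫ x in B, Φ x ∂μ + K := by
          rw [integral_add hindint (integrable_const _), integral_indicator measurableSet_Ioo]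
          simp [hB]
      _ ≤ _ := by linarith
  -- lower bound
  set s := 2 * D / (3 * N) with hsdef
  have hs0 : 0 < s := by positivity
  set S := Set.Icc (x0 - s) (x0 + s) \ {x0} with hS
  have hSm : MeasurableSet S := measurableSet_Icc.diff (measurableSet_singleton _)
  have hSB : S ⊆ B := by
    intro x hx
    exact ⟨by linarith [hx.1.1], by linarith [hx.1.2]⟩
  have hSv : volume S = ENNReal.ofReal (2 * s) := by
    rw [hS, measure_sdiff_null (by simp), Real.volume_Icc]; congr 1; ring
  have hμS : m * (4 * D / (3 * N)) ≤ μ.real S := by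
    have := hlo S hSB hSm
    rw [hSv, ← ENNReal.ofReal_mul hm.le] at this
    have h2 := (ENNReal.ofReal_le_iff_le_toReal (measure_ne_top μ S)).1 this
    have e : m * (4 * D / (3 * N)) = m * (2 * s) := by rw [hsdef]; ring
    rw [e]; exact h2
  have hlow : ∀ x, S.indicator (fun _ => ((25/27)^4 : ℝ)) x ≤ (G.eval x)^2 := by
    intro x
    by_cases hx : x ∈ S
    · rw [Set.indicator_of_mem hx]
      have hxs : |x - x0| ≤ s := abs_le.2 ⟨by linarith [hx.1.1], by linarith [hx.1.2]⟩
      have hne : 0 < |x - x0| := abs_pos.2 (sub_ne_zero.2 hx.2)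
      have hsD : s ≤ D := by
        rw [hsdef, div_le_iff₀ (by positivity)]; nlinarith
      obtain ⟨t, ht0, ht, -, -, h3⟩ := hpt x (hxs.trans hsD)
      have htp : 0 < t := by rw [ht]; positivity
      have ht2 : t ≤ 2/3 := by
        rw [ht, div_le_iff₀ hD]
        rw [hsdef, le_div_iff₀ (by positivity)] at hxs
        linarith
      have h4 := h3 ht2
      have h5 : 25/27 ≤ Real.sqrt (G.eval x) := by
        rw [mul_comm] at h4; exact le_of_mul_le_mul_left h4 htp
      have : (G.eval x)^2 = (Real.sqrt (G.eval x))^4 := by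
        conv_lhs => rw [← Real.sq_sqrt (hGnn x)]
        ring
      rw [this]; gcongr
    · rw [Set.indicator_of_notMem hx]; positivity
  have hG2 : Integrable (fun x => (G.eval x)^2) μ :=
    (poly_int μ hc (G*G)).congr (ae_of_all _ fun x => by beta_reduce; rw [eval_mul, sq])
  have hL : (25/27)^4 * (m * (4 * D / (3 * N))) ≤ ∫ x, (G.eval x)^2 ∂μ := by
    calc _ ≤ (25/27)^4 * μ.real S := by gcongr
      _ = ∫ x, S.indicator (fun _ => ((25/27)^4 : ℝ)) x ∂μ := by
        rw [integral_indicator_const _ hSm, smul_eq_mul, mul_comm]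
      _ ≤ _ := integral_mono ((integrable_const _).indicator hSm) hG2 hlow
  have hq := quad_nonpos μ hc p hdeg hlead horth n (by omega) ((C (h^2) - (X - C x0)^2) * G^2) (by
    refine natDegree_mul_le.trans_lt ?_
    have h1 : (C (h^2) - (X - C x0)^2 : ℝ[X]).natDegree ≤ 2 := by compute_degree
    have h2 : (G^2).natDegree ≤ 2 * (4*j) := natDegree_pow_le.trans (by omega)
    omega) (by
    intro x hx
    have := hroot x hx
    have h1 : h^2 ≤ (x-x0)^2 := by rw [← sq_abs (x-x0)]; gcongr
    simp only [eval_mul, eval_sub, eval_pow, eval_C, eval_X]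
    exact mul_nonpos_of_nonpos_of_nonneg (by linarith) (by positivity))
  have hq2 : h^2 * ∫ x, (G.eval x)^2 ∂μ ≤ ∫ x, (x-x0)^2 * (G.eval x)^2 ∂μ := by
    have e : ∀ x, ((C (h^2) - (X - C x0)^2) * G^2).eval x = h^2 * (G.eval x)^2 - (x-x0)^2 * (G.eval x)^2 := by
      intro x; simp only [eval_mul, eval_sub, eval_pow, eval_C, eval_X]; ring
    rw [integral_congr_ae (Filter.Eventually.of_forall e), integral_sub (hG2.const_mul _), integral_const_mul] at hq
    · linarith
    · have := poly_int μ hc ((X - C x0)^2 * G^2)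
      simpa using this
  calc _ ≤ h^2 * ∫ x, (G.eval x)^2 ∂μ := by gcongr
    _ ≤ _ := hq2.trans hU
end

lemma final_arith (W m M dd D N r h : ℝ) (hW : 1 ≤ W) (hm : 0 < m) (hM0 : 0 < M)
    (hM : M ≤ 21/20 * W * m) (hdd : 0 < dd) (hD : D = 21/20 * dd) (hN : 0 < N) (hr : 0 < r)
    (hh : 0 ≤ h) (hNh : 98/100 * Real.pi * dd * W ≤ N * h)
    (hNbig : D^3 / (r^2 * (m * dd^2)) < N)
    (hgap : h ^ 2 * ((25/27)^4 * (m * (4 * D / (3 * N)))) ≤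
      M * (2 * Real.pi * D^3 / N^3) + D^4 / (N^4 * r^2)) : False := by
  have hD0 : 0 < D := by rw [hD]; positivity
  have hpi := Real.pi_gt_three
  have h1 : (N * h)^2 * ((25/27)^4 * (4/3) * m) ≤ M * (2 * Real.pi * D^2) + D^3 / (N * r^2) := by
    have := mul_le_mul_of_nonneg_right hgap (by positivity : 0 ≤ N^3 / D)
    calc _ = h ^ 2 * ((25/27)^4 * (m * (4 * D / (3 * N)))) * (N^3 / D) := by field_simp
      _ ≤ _ := this
      _ = _ := by field_simp
  have h2 : D^3 / (N * r^2) < m * dd^2 := by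
    rw [div_lt_iff₀ (by positivity)] at hNbig ⊢
    nlinarith
  have h3 : (98/100 * Real.pi * dd * W)^2 * ((25/27)^4 * (4/3) * m) ≤
      (N * h)^2 * ((25/27)^4 * (4/3) * m) := by gcongr
  have h4 : M * (2 * Real.pi * D^2) ≤ (21/20 * W * m) * (2 * Real.pi * D^2) := by gcongr
  set A := m * dd^2 with hA
  have hA0 : 0 < A := by positivity
  have h5 : (98/100 * Real.pi * dd * W)^2 * ((25/27)^4 * (4/3) * m)
      = (98/100)^2 * (25/27)^4 * (4/3) * (Real.pi * Real.pi * W * W * A) := by rw [hA]; ring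
  have h6 : (21/20 * W * m) * (2 * Real.pi * D^2) = (21/20)^3 * 2 * (Real.pi * W * A) := by
    rw [hD, hA]; ring
  have h7 : Real.pi * W * A * 3 ≤ Real.pi * Real.pi * W * W * A := by
    have e : Real.pi * Real.pi * W * W * A = Real.pi * W * A * (Real.pi * W) := by ring
    rw [e]
    gcongr
    nlinarith
  have h8 : 3 * A ≤ Real.pi * W * A := by
    gcongr; nlinarith
  have h9 : (94/100 : ℝ) ≤ (98/100)^2 * (25/27)^4 * (4/3) := by norm_num
  have h10 : 94/100 * (Real.pi * Real.pi * W * W * A) ≤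
    (98/100)^2 * (25/27)^4 * (4/3) * (Real.pi * Real.pi * W * W * A) := by gcongr
  nlinarith

lemma core (μ : Measure ℝ) [IsProbabilityMeasure μ] (hc : IsCompact (measSupport μ))
    (p : ℕ → Polynomial ℝ)
    (hdeg : ∀ k, (p k).natDegree = k)
    (hlead : ∀ k, 0 < (p k).leadingCoeff)
    (horth : ∀ k m, ∫ x, (p k).eval x * (p m).eval x ∂μ = if k = m then 1 else 0)
    (E dd W δ m M : ℝ) (hdd : 0 < dd) (hsupp : ∀ x ∈ measSupport μ, |x - E| ≤ dd)
    (hW : 1 ≤ W) (hδ : 0 < δ) (hm : 0 < m) (hM0 : 0 < M) (hM : M ≤ 21/20 * W * m)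
    (hup : ∀ S ⊆ Set.Ioo (E - δ) (E + δ), MeasurableSet S → μ S ≤ ENNReal.ofReal M * volume S)
    (hlo : ∀ S ⊆ Set.Ioo (E - δ) (E + δ), MeasurableSet S → ENNReal.ofReal m * volume S ≤ μ S)
    (z1 zm1 : ℕ → ℝ) (N0 : ℕ)
    (hz : ∀ n ≥ N0, IsLeast {x : ℝ | (p n).eval x = 0 ∧ E < x} (z1 n) ∧
      IsGreatest {x : ℝ | (p n).eval x = 0 ∧ x ≤ E} (zm1 n)) :
    limsup (fun n : ℕ => (n : ℝ) * (z1 n - zm1 n)) atTop ≤ 4 * Real.pi * dd * W := by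
  have hev0 : ∀ᶠ n : ℕ in atTop, 0 ≤ (n : ℝ) * (z1 n - zm1 n) := by
    filter_upwards [eventually_ge_atTop N0] with n hn
    have h1 := (hz n hn).1.1.2
    have h2 := (hz n hn).2.1.2
    have : 0 ≤ z1 n - zm1 n := by linarith
    positivity
  have hpi := Real.pi_pos
  set D := 21/20 * dd with hD
  set r := δ/2 with hr
  have hr0 : 0 < r := by positivity
  have hD0 : 0 < D := by positivity
  set T := 4 * Real.pi * dd * W with hT
  have hT0 : 0 < T := by positivity
  refine limsup_le_of_le (IsCoboundedUnder.of_frequently_ge hev0.frequently) ?_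
  have hbig : ∀ X : ℝ, ∀ᶠ n : ℕ in atTop, X < (n:ℝ) := fun X =>
    tendsto_natCast_atTop_atTop.eventually_gt_atTop X
  filter_upwards [eventually_ge_atTop N0, eventually_ge_atTop 200, hbig (T / (δ/2)), hbig (T / (dd/10)),
    hbig (3 * (2 * D / (3 * r))), hbig (3 * (D^3 / (r^2 * (m * dd^2))))] with n hn hn2 hb1 hb2 hb3 hb4
  by_contra! hcon
  have hn0 : (0:ℝ) < n := by have : 0 < n := by omega
                             exact_mod_cast this
  set L := T / n with hL
  have hL0 : 0 < L := by positivity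
  have hLδ : L < δ/2 := by rw [hL, div_lt_comm₀ hn0 (by positivity)]; exact hb1
  have hLd : L < dd/10 := by rw [hL, div_lt_comm₀ hn0 (by positivity)]; exact hb2
  have hLz : L < z1 n - zm1 n := by
    rw [hL, div_lt_iff₀ hn0]; linarith
  obtain ⟨⟨⟨-, hzE⟩, hleast⟩, ⟨⟨-, hzE'⟩, hgreat⟩⟩ := hz n hn
  set u := max (zm1 n) (E - L) with hu
  have hu1 : zm1 n ≤ u := le_max_left _ _
  have hu2 : E - L ≤ u := le_max_right _ _
  have hu3 : u ≤ E := max_le hzE' (by linarith)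
  have hu4 : u + L ≤ z1 n := by
    rcases max_choice (zm1 n) (E - L) with h | h <;> rw [← hu] at h <;> linarith
  set x0 := u + L/2 with hx0
  set j := (n - 2) / 4 with hj
  have hj1 : 4 * j + 2 ≤ n := by omega
  have hj2 : n ≤ 4 * j + 5 := by omega
  have hj2' : (n:ℝ) ≤ 4 * j + 5 := by exact_mod_cast hj2
  have hn2' : (200:ℝ) ≤ n := by exact_mod_cast hn2
  set N : ℝ := 2 * j + 1 with hN
  have hNn : 49/100 * (n:ℝ) ≤ N := by rw [hN]; linarith
  have hN0 : 0 < N := by linarith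
  have hsub : Set.Ioo (x0 - r) (x0 + r) ⊆ Set.Ioo (E - δ) (E + δ) := by
    intro x hx
    exact ⟨by linarith [hx.1], by linarith [hx.2]⟩
  have hgap := gap_ineq μ hc p hdeg hlead horth n j (by omega) N hN x0 (L/2) D r m M hD0 hr0 hm hM0
    (by positivity)
    (by
      intro x hx
      have := abs_le.1 (hsupp x hx)
      rw [abs_le]; constructor <;> linarith)
    (fun S hS => hup S (hS.trans hsub)) (fun S hS => hlo S (hS.trans hsub))
    (by
      intro x hx
      rcases lt_or_ge E x with h | h
      · have h1 := hleast ⟨hx, h⟩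
        refine le_trans ?_ (le_abs_self _)
        linarith
      · have h1 := hgreat ⟨hx, h⟩
        refine le_trans ?_ (neg_le_abs _)
        linarith)
    (by
      have e : 2 * D / (3 * N) = 2 * D / (3 * r) * r / N := by field_simp
      rw [e, div_lt_iff₀ hN0]
      have : 2 * D / (3 * r) < N := by linarith
      nlinarith)
  refine final_arith W m M dd D N r (L/2) hW hm hM0 hM hdd hD hN0 hr0 (by positivity) ?_ (by linarith) hgap
  calc 98/100 * Real.pi * dd * W = 49/100 * (n:ℝ) * (L/2) := by rw [hL, hT]; field_simp; ring
    _ ≤ _ := by gcongr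

theorem stmt_17 (μ : Measure ℝ) [IsProbabilityMeasure μ]
    (hcompact : IsCompact (measSupport μ)) (hinf : (measSupport μ).Infinite)
    (p : ℕ → Polynomial ℝ)
    (hdeg : ∀ k, (p k).natDegree = k)
    (hlead : ∀ k, 0 < (p k).leadingCoeff)
    (horth : ∀ k m, ∫ x, (p k).eval x * (p m).eval x ∂μ = if k = m then 1 else 0)
    (Em Ep : ℝ) (hEm : Em = sInf (measSupport μ)) (hEp : Ep = sSup (measSupport μ))
    (c d : ℝ) (hcd : c ≤ d) (w : ℝ → ℝ)
    -- μ is purely absolutely continuous on I = [c,d] with density w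
    (hac : ∀ S : Set ℝ, S ⊆ Set.Icc c d → MeasurableSet S →
      μ S = ∫⁻ x in S, ENNReal.ofReal (w x) ∂volume)
    -- 0 < inf_I w ≤ sup_I w < ∞
    (wm wp : ℝ) (hwm : 0 < wm)
    (hwbd : ∀ x ∈ Set.Icc c d, wm ≤ w x ∧ w x ≤ wp)
    (E : ℝ) (hE : E ∈ Set.Ioo c d)
    (z1 zm1 : ℕ → ℝ) (N0 : ℕ)
    (hz : ∀ n ≥ N0, IsLeast {x : ℝ | (p n).eval x = 0 ∧ E < x} (z1 n) ∧
      IsGreatest {x : ℝ | (p n).eval x = 0 ∧ x ≤ E} (zm1 n)) :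
    (∀ Lr : ℝ,
      Tendsto (fun δ : ℝ =>
          sSup {v : ℝ | ∃ x : ℝ, |x - E| < δ ∧ v = w x} /
          sInf {v : ℝ | ∃ x : ℝ, |x - E| < δ ∧ v = w x})
        (nhdsWithin 0 (Set.Ioi 0)) (nhds Lr) →
      limsup (fun n : ℕ => (n : ℝ) * (z1 n - zm1 n)) atTop
        ≤ 4 * Real.pi * max (Ep - E) (E - Em) * Lr) ∧
    (ContinuousAt w E →
      limsup (fun n : ℕ => (n : ℝ) * (z1 n - zm1 n)) atTop
        ≤ 4 * Real.pi * max (Ep - E) (E - Em)) := by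
  have hsuppE : ∀ x ∈ measSupport μ, Em ≤ x ∧ x ≤ Ep := by
    intro x hx
    exact ⟨hEm ▸ csInf_le hcompact.bddBelow hx, hEp ▸ le_csSup hcompact.bddAbove hx⟩
  set dd := max (Ep - E) (E - Em) with hdd
  have hd1 : Ep - E ≤ dd := le_max_left _ _
  have hd2 : E - Em ≤ dd := le_max_right _ _
  have hdd0 : 0 < dd := by
    obtain ⟨a, ha, b, hb, hab⟩ := hinf.nontrivial
    have h1 := hsuppE a ha
    have h2 := hsuppE b hb
    rcases lt_or_gt_of_ne hab with h | h <;> linarith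
  have hsupp : ∀ x ∈ measSupport μ, |x - E| ≤ dd := by
    intro x hx
    have := hsuppE x hx
    rw [abs_le]; constructor <;> linarith
  -- reduction to bounds on w
  have main : ∀ W δ m M : ℝ, 1 ≤ W → 0 < δ → 0 < m → 0 < M → M ≤ 21/20 * W * m →
      Set.Ioo (E - δ) (E + δ) ⊆ Set.Icc c d →
      (∀ x, |x - E| < δ → m ≤ w x ∧ w x ≤ M) →
      limsup (fun n : ℕ => (n : ℝ) * (z1 n - zm1 n)) atTop ≤ 4 * Real.pi * dd * W := by
    intro W δ m M hW hδ hm hM0 hM hsub hw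
    have hw' : ∀ x ∈ Set.Ioo (E - δ) (E + δ), m ≤ w x ∧ w x ≤ M := by
      intro x hx
      exact hw x (abs_lt.2 ⟨by linarith [hx.1], by linarith [hx.2]⟩)
    refine core μ hcompact p hdeg hlead horth E dd W δ m M hdd0 hsupp hW hδ hm hM0 hM ?_ ?_ z1 zm1 N0 hz
    · intro S hS hSm
      rw [hac S (hS.trans hsub) hSm, ← setLIntegral_const]
      exact setLIntegral_mono' hSm fun x hx => ENNReal.ofReal_le_ofReal (hw' x (hS hx)).2
    · intro S hS hSm
      rw [hac S (hS.trans hsub) hSm, ← setLIntegral_const]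
      exact setLIntegral_mono' hSm fun x hx => ENNReal.ofReal_le_ofReal (hw' x (hS hx)).1
  obtain ⟨δ0, hδ0, hδc⟩ : ∃ δ0 > 0, ∀ δ ≤ δ0, Set.Ioo (E - δ) (E + δ) ⊆ Set.Icc c d := by
    refine ⟨min (E - c) (d - E), lt_min (by linarith [hE.1]) (by linarith [hE.2]), ?_⟩
    intro δ hδ x hx
    have h1 := hδ.trans (min_le_left _ _)
    have h2 := hδ.trans (min_le_right _ _)
    exact ⟨by linarith [hx.1], by linarith [hx.2]⟩
  constructor
  · intro Lr hLr
    set A : ℝ → Set ℝ := fun δ => {v : ℝ | ∃ x : ℝ, |x - E| < δ ∧ v = w x} with hA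
    have hfacts : ∀ δ, 0 < δ → δ ≤ δ0 → 0 < sInf (A δ) ∧ sInf (A δ) ≤ sSup (A δ) ∧
        ∀ x, |x - E| < δ → sInf (A δ) ≤ w x ∧ w x ≤ sSup (A δ) := by
      intro δ hδ hle
      have hb : ∀ v ∈ A δ, wm ≤ v ∧ v ≤ wp := by
        rintro v ⟨x, hx, rfl⟩
        apply hwbd
        apply hδc δ hle
        rw [abs_lt] at hx
        exact ⟨by linarith [hx.1], by linarith [hx.2]⟩
      have hba : BddAbove (A δ) := ⟨wp, fun v hv => (hb v hv).2⟩
      have hbb : BddBelow (A δ) := ⟨wm, fun v hv => (hb v hv).1⟩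
      have hne : (A δ).Nonempty := ⟨w E, E, by simpa using hδ, rfl⟩
      refine ⟨hwm.trans_le (le_csInf hne fun v hv => (hb v hv).1), csInf_le_csSup hne hbb hba, ?_⟩
      intro x hx
      exact ⟨csInf_le hbb ⟨x, hx, rfl⟩, le_csSup hba ⟨x, hx, rfl⟩⟩
    have hev : ∀ᶠ δ in nhdsWithin (0:ℝ) (Set.Ioi 0), 0 < δ ∧ δ ≤ δ0 := by
      filter_upwards [Ioc_mem_nhdsGT hδ0] with δ hδ using hδ
    have hLr1 : 1 ≤ Lr := by
      refine ge_of_tendsto hLr ?_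
      filter_upwards [hev] with δ hδ
      obtain ⟨h1, h2, -⟩ := hfacts δ hδ.1 hδ.2
      exact (one_le_div h1).2 h2
    have hev2 := hLr.eventually (gt_mem_nhds (show Lr < 21/20 * Lr by linarith))
    obtain ⟨δ, ⟨hδ1, hδ2⟩, hδ3⟩ := (hev.and hev2).exists
    obtain ⟨h1, h2, h3⟩ := hfacts δ hδ1 hδ2
    refine main Lr δ (sInf (A δ)) (sSup (A δ)) hLr1 hδ1 h1 (h1.trans_le h2) ?_ (hδc δ hδ2) h3
    exact ((div_lt_iff₀ h1).1 hδ3).le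
  · intro hcont
    have hwE : 0 < w E := hwm.trans_le (hwbd E ⟨hE.1.le, hE.2.le⟩).1
    obtain ⟨δ1, hδ1, h1⟩ := Metric.continuousAt_iff.1 hcont (w E / 100) (by positivity)
    have := main 1 (min δ0 δ1) (99/100 * w E) (101/100 * w E) le_rfl (lt_min hδ0 hδ1) (by positivity)
      (by positivity) (by linarith) (hδc _ (min_le_left _ _)) (by
        intro x hx
        have := h1 (x := x) (by rw [Real.dist_eq]; exact hx.trans_le (min_le_right _ _))
        rw [Real.dist_eq, abs_lt] at this
        constructor <;> linarith [this.1, this.2])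
    simpa using this
end
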